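/- Let Ω ⊂ ℝ^d be a nonempty, bounded, open set, let 0 < s < 1, 1 ≤ p < ∞ and α, β ≥ 0. If sp + α + β < d − dim̄_M(∂Ω), then W_0^{s,p;α,β}(Ω) = W^{s,p;α,β}(Ω), i.e. C_c^∞(Ω) ∩ W^{s,p;α,β}(Ω) is dense in W^{s,p;α,β}(Ω). -/

import Mathlib

open MeasureTheory Metric Set Filter
open scoped ENNReal NNReal

noncomputable section

/-- Euclidean space `ℝ^d`. -/
abbrev Rd (d : ℕ) := EuclideanSpace ℝ (Fin d)

/-- `d_Ω(x)`: the distance from `x` to the boundary `∂Ω`. -/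
def distBd {d : ℕ} (Ω : Set (Rd d)) (x : Rd d) : ℝ := Metric.infDist x (frontier Ω)

/-- The `p`-th power of the weighted Gagliardo seminorm `[f]_{W^{s,p;α,β}(Ω)}^p`, with
power-of-distance-to-the-boundary weights `d_Ω(y)^{-β} d_Ω(x)^{-α}`. -/
def gagP {d : ℕ} (Ω : Set (Rd d)) (s p α β : ℝ) (f : Rd d → ℝ) : ℝ≥0∞ :=
  ∫⁻ x in Ω, ∫⁻ y in Ω, ENNReal.ofReal
    (|f x - f y| ^ p / dist x y ^ ((d : ℝ) + s * p)
      * distBd Ω y ^ (-β) * distBd Ω x ^ (-α))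

/-- The weighted Gagliardo seminorm `[f]_{W^{s,p;α,β}(Ω)}`. -/
def gagSemi {d : ℕ} (Ω : Set (Rd d)) (s p α β : ℝ) (f : Rd d → ℝ) : ℝ≥0∞ :=
  gagP Ω s p α β f ^ (1 / p)

/-- Membership in the weighted fractional Sobolev space `W^{s,p;α,β}(Ω)`. -/
def memW {d : ℕ} (Ω : Set (Rd d)) (s p α β : ℝ) (f : Rd d → ℝ) : Prop :=
  MemLp f (ENNReal.ofReal p) (volume.restrict Ω) ∧ gagP Ω s p α β f < ⊤

/-- The norm `‖f‖_{L^p(Ω)} + [f]_{W^{s,p;α,β}(Ω)}` (as an extended real). -/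
def wNorm {d : ℕ} (Ω : Set (Rd d)) (s p α β : ℝ) (f : Rd d → ℝ) : ℝ≥0∞ :=
  eLpNorm f (ENNReal.ofReal p) (volume.restrict Ω) + gagSemi Ω s p α β f

/-- Membership in `W_0^{s,p;α,β}(Ω)`: the closure of `C_c^∞(Ω) ∩ W^{s,p;α,β}(Ω)` in
`W^{s,p;α,β}(Ω)`. -/
def memW0 {d : ℕ} (Ω : Set (Rd d)) (s p α β : ℝ) (f : Rd d → ℝ) : Prop :=
  memW Ω s p α β f ∧ ∀ ε : ℝ, 0 < ε → ∃ φ : Rd d → ℝ,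
    ContDiff ℝ (⊤ : ℕ∞) φ ∧ HasCompactSupport φ ∧ tsupport φ ⊆ Ω ∧ memW Ω s p α β φ ∧
    wNorm Ω s p α β (fun x => f x - φ x) < ENNReal.ofReal ε

/-- The defining set for the lower Assouad codimension: admissible exponents `q`. -/
def lowerCodimSet {d : ℕ} (E : Set (Rd d)) : Set ℝ :=
  {q : ℝ | 0 ≤ q ∧ ∃ C : ℝ, 1 ≤ C ∧ ∀ x ∈ E, ∀ r R : ℝ, 0 < r → r < R →
    ENNReal.ofReal R < EMetric.diam E →
    volume (Metric.cthickening r E ∩ Metric.ball x R)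
      ≤ ENNReal.ofReal (C * (r / R) ^ q) * volume (Metric.ball x R)}

/-- The lower Assouad codimension. -/
def lowerCodimA {d : ℕ} (E : Set (Rd d)) : ℝ := sSup (lowerCodimSet E)

/-- The upper Assouad codimension. -/
def upperCodimA {d : ℕ} (E : Set (Rd d)) : ℝ :=
  sInf {q : ℝ | 0 ≤ q ∧ ∃ c : ℝ, 0 < c ∧ ∀ x ∈ E, ∀ r R : ℝ, 0 < r → r < R →
    ENNReal.ofReal R < EMetric.diam E →
    ENNReal.ofReal (c * (r / R) ^ q) * volume (Metric.ball x R)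
      ≤ volume (Metric.cthickening r E ∩ Metric.ball x R)}

/-- The upper Minkowski dimension. -/
def upperMinkDim {d : ℕ} (E : Set (Rd d)) : ℝ :=
  sInf {t : ℝ | 0 ≤ t ∧
    Filter.limsup (fun r : ℝ =>
        volume (Metric.cthickening r E) * ENNReal.ofReal (r ^ (t - (d : ℝ))))
      (nhdsWithin 0 (Set.Ioi 0)) = 0}

/-- Uniform domain: any two points are joined by a `1`-Lipschitz (arc-length parameterized)
curve of length `≤ C|x-y|` staying quantitatively away from the boundary. -/
def IsUniformDomain {d : ℕ} (Ω : Set (Rd d)) : Prop :=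
  ∃ C : ℝ, 1 ≤ C ∧ ∀ x ∈ Ω, ∀ y ∈ Ω, ∃ (l : ℝ) (γ : ℝ → Rd d),
    0 ≤ l ∧ l ≤ C * dist x y ∧ γ 0 = x ∧ γ l = y ∧
    (∀ t ∈ Set.Icc 0 l, γ t ∈ Ω) ∧
    LipschitzOnWith 1 γ (Set.Icc 0 l) ∧
    ∀ t ∈ Set.Icc 0 l,
      min (dist (γ t) x) (dist (γ t) y) / C ≤ Metric.infDist (γ t) (frontier Ω)

/-- `κ`-plumpness. -/
def IsPlump {d : ℕ} (κ : ℝ) (E : Set (Rd d)) : Prop :=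
  ∀ r : ℝ, 0 < r → ENNReal.ofReal r < EMetric.diam E →
    ∀ x ∈ closure E, ∃ z ∈ Metric.closedBall x r, Metric.ball z (κ * r) ⊆ E

/-- `σ`-homogeneity: `|V(E,x,λ,r)| ≤ L r^d λ^σ` where
`V(E,x,λ,r) = {y : dist(y,E) ≤ r, |x-y| ≤ λ r}`. -/
def IsHomog {d : ℕ} (σ : ℝ) (E : Set (Rd d)) : Prop :=
  ∃ L : ℝ, 0 < L ∧ ∀ x ∈ E, ∀ lam r : ℝ, 1 ≤ lam → 0 < r →
    volume (Metric.cthickening r E ∩ Metric.closedBall x (lam * r))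
      ≤ ENNReal.ofReal (L * r ^ (d : ℝ) * lam ^ σ)

/-- The axis-parallel cube with corner `a` and side length `l`. -/
def cube {d : ℕ} (a : Rd d) (l : ℝ) : Set (Rd d) :=
  {y | ∀ i, y i ∈ Set.Icc (a i) (a i + l)}

/-- Muckenhoupt `A₁` class: `|Q|⁻¹ ∫_Q w ≤ A inf_Q w` for all cubes `Q`. -/
def IsA1 {d : ℕ} (w : Rd d → ℝ) : Prop :=
  (∀ x, 0 < w x) ∧ ∃ A : ℝ, 0 < A ∧ ∀ (a : Rd d) (l : ℝ), 0 < l →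
    ∫⁻ x in cube a l, ENNReal.ofReal (w x)
      ≤ ENNReal.ofReal (A * l ^ (d : ℝ)) * ⨅ y ∈ cube a l, ENNReal.ofReal (w y)

/-- The `p`-th power of the Gagliardo seminorm with general weights `w(x) v(y)`. -/
def gagPW {d : ℕ} (Ω : Set (Rd d)) (s p : ℝ) (w v f : Rd d → ℝ) : ℝ≥0∞ :=
  ∫⁻ x in Ω, ∫⁻ y in Ω, ENNReal.ofReal
    (|f x - f y| ^ p / dist x y ^ ((d : ℝ) + s * p) * w x * v y)

/-- Membership in `W^{s,p;w,v}(Ω)` for general weights. -/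
def memWgen {d : ℕ} (Ω : Set (Rd d)) (s p : ℝ) (w v f : Rd d → ℝ) : Prop :=
  MemLp f (ENNReal.ofReal p) (volume.restrict Ω) ∧ gagPW Ω s p w v f < ⊤

/-- The norm of `W^{s,p;w,v}(Ω)` (as an extended real). -/
def wNormGen {d : ℕ} (Ω : Set (Rd d)) (s p : ℝ) (w v f : Rd d → ℝ) : ℝ≥0∞ :=
  eLpNorm f (ENNReal.ofReal p) (volume.restrict Ω) + gagPW Ω s p w v f ^ (1 / p)

/-- Membership in `W_0^{s,p;w,v}(Ω)`. -/
def memW0gen {d : ℕ} (Ω : Set (Rd d)) (s p : ℝ) (w v f : Rd d → ℝ) : Prop :=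
  memWgen Ω s p w v f ∧ ∀ ε : ℝ, 0 < ε → ∃ φ : Rd d → ℝ,
    ContDiff ℝ (⊤ : ℕ∞) φ ∧ HasCompactSupport φ ∧ tsupport φ ⊆ Ω ∧ memWgen Ω s p w v φ ∧
    wNormGen Ω s p w v (fun x => f x - φ x) < ENNReal.ofReal ε

/-- Membership in `W_c^{s,p;w,v}(Ω)`: the closure of compactly supported measurable
functions. -/
def memWcgen {d : ℕ} (Ω : Set (Rd d)) (s p : ℝ) (w v f : Rd d → ℝ) : Prop :=
  memWgen Ω s p w v f ∧ ∀ ε : ℝ, 0 < ε → ∃ g : Rd d → ℝ,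
    Measurable g ∧ HasCompactSupport g ∧ tsupport g ⊆ Ω ∧ memWgen Ω s p w v g ∧
    wNormGen Ω s p w v (fun x => f x - g x) < ENNReal.ofReal ε

end

theorem tendsto_eLpNorm_zero_of_dominated {X : Type*} [MeasurableSpace X] {ν : Measure X}
    {p : ℝ} (hp : 0 < p) {F : ℕ → X → ℝ} {H : X → ℝ}
    (hF : ∀ n, AEStronglyMeasurable (F n) ν) (hH : MemLp H (ENNReal.ofReal p) ν)
    (hb : ∀ n, ∀ᵐ x ∂ν, |F n x| ≤ H x)
    (hlim : ∀ᵐ x ∂ν, Tendsto (fun n => F n x) atTop (nhds 0)) :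
    Tendsto (fun n => eLpNorm (F n) (ENNReal.ofReal p) ν) atTop (nhds 0) := by
  have hp0 : ENNReal.ofReal p ≠ 0 := by simpa using hp
  have hH' := hH.2
  simp only [eLpNorm_eq_lintegral_rpow_enorm_toReal hp0 ENNReal.ofReal_ne_top,
    ENNReal.toReal_ofReal hp.le] at hH' ⊢
  have key : Tendsto (fun n => ∫⁻ x, ‖F n x‖ₑ ^ p ∂ν) atTop (nhds (∫⁻ _, 0 ∂ν)) := by
    refine tendsto_lintegral_of_dominated_convergence' (fun x => ‖H x‖ₑ ^ p)
      (fun n => (hF n).enorm.pow_const p) (fun n => ?_) ?_ ?_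
    · filter_upwards [hb n] with x hx
      refine ENNReal.rpow_le_rpow ?_ hp.le
      rw [enorm_le_iff_norm_le]
      exact hx.trans (le_abs_self _)
    · intro h
      rw [h, ENNReal.top_rpow_of_pos (by positivity)] at hH'
      exact lt_irrefl _ hH'
    · filter_upwards [hlim] with x hx
      have := (hx.enorm).ennrpow_const p
      simpa [ENNReal.zero_rpow_of_pos hp] using this
  have := key.ennrpow_const (1 / p)
  simpa [hp] using this

theorem eLpNorm_integral_le {X Z : Type*} [MeasurableSpace X] [MeasurableSpace Z]
    {ν : Measure X} [SFinite ν] {π : Measure Z} [IsProbabilityMeasure π]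
    {p : ℝ} (hp : 1 ≤ p) {F : Z → X → ℝ} (hF : Measurable (Function.uncurry F))
    {C : ℝ≥0∞} (hC : ∀ᵐ z ∂π, eLpNorm (F z) (ENNReal.ofReal p) ν ≤ C) :
    eLpNorm (fun x => ∫ z, F z x ∂π) (ENNReal.ofReal p) ν ≤ C := by
  have hp' : 0 < p := by linarith
  have hp0 : ENNReal.ofReal p ≠ 0 := by simpa using hp'
  simp only [eLpNorm_eq_lintegral_rpow_enorm_toReal hp0 ENNReal.ofReal_ne_top,
    ENNReal.toReal_ofReal hp'.le] at hC ⊢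
  have hFe : Measurable (fun q : X × Z => ‖F q.2 q.1‖ₑ ^ p) :=
    ((hF.comp measurable_swap).enorm).pow_const p
  have h1 : ∀ x, ‖∫ z, F z x ∂π‖ₑ ^ p ≤ ∫⁻ z, ‖F z x‖ₑ ^ p ∂π := by
    intro x
    have hm : AEStronglyMeasurable (fun z => F z x) π :=
      (hF.comp (measurable_id.prodMk measurable_const)).aestronglyMeasurable
    have h2 := eLpNorm_le_eLpNorm_of_exponent_le (p := 1) (q := ENNReal.ofReal p)
      (by simpa using hp) hm
    rw [eLpNorm_one_eq_lintegral_enorm,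
      eLpNorm_eq_lintegral_rpow_enorm_toReal hp0 ENNReal.ofReal_ne_top,
      ENNReal.toReal_ofReal hp'.le] at h2
    calc ‖∫ z, F z x ∂π‖ₑ ^ p ≤ ((∫⁻ z, ‖F z x‖ₑ ^ p ∂π) ^ (1 / p)) ^ p :=
          ENNReal.rpow_le_rpow ((enorm_integral_le_lintegral_enorm _).trans h2) hp'.le
      _ = _ := by rw [← ENNReal.rpow_mul]; simp [hp'.ne']
  have h3 : ∫⁻ x, ‖∫ z, F z x ∂π‖ₑ ^ p ∂ν ≤ C ^ p := by
    calc _ ≤ ∫⁻ x, ∫⁻ z, ‖F z x‖ₑ ^ p ∂π ∂ν := lintegral_mono h1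
      _ = ∫⁻ z, ∫⁻ x, ‖F z x‖ₑ ^ p ∂ν ∂π := lintegral_lintegral_swap hFe.aemeasurable
      _ ≤ ∫⁻ z, C ^ p ∂π := by
          refine lintegral_mono_ae ?_
          filter_upwards [hC] with z hz
          have := ENNReal.rpow_le_rpow hz hp'.le
          rwa [← ENNReal.rpow_mul, one_div_mul_cancel hp'.ne', ENNReal.rpow_one] at this
      _ = C ^ p := by simp
  calc _ ≤ (C ^ p) ^ (1 / p) := ENNReal.rpow_le_rpow h3 (by positivity)
    _ = C := by rw [← ENNReal.rpow_mul]; simp [hp'.ne']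

theorem tendsto_eLpNorm_translate_sub {V : Type*} [NormedAddCommGroup V] [NormedSpace ℝ V]
    [FiniteDimensional ℝ V] [MeasurableSpace V] [BorelSpace V] {ν : Measure V}
    [ν.IsAddHaarMeasure] {p : ℝ} (hp : 1 ≤ p) {G : V → ℝ}
    (hG : MemLp G (ENNReal.ofReal p) ν) :
    Tendsto (fun z => eLpNorm (fun x => G x - G (z + x)) (ENNReal.ofReal p) ν)
      (nhds 0) (nhds 0) := by
  have : Fact (1 ≤ ENNReal.ofReal p) := ⟨by simpa using hp⟩
  have : Fact (ENNReal.ofReal p ≠ ∞) := ⟨ENNReal.ofReal_ne_top⟩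
  have hc : Continuous (fun z : V => (DomAddAct.mk z) +ᵥ hG.toLp G) := by
    have : Continuous (DomAddAct.mk : V → Vᵈᵃᵃ) := DomAddAct.continuous_mk
    fun_prop
  have ht : Tendsto (fun z : V => eLpNorm
      ((hG.toLp G - ((DomAddAct.mk z) +ᵥ hG.toLp G) : Lp ℝ (ENNReal.ofReal p) ν) : V → ℝ)
      (ENNReal.ofReal p) ν) (nhds 0) (nhds 0) := by
    have h1 : Tendsto (fun z : V => edist (hG.toLp G) ((DomAddAct.mk z) +ᵥ hG.toLp G)) (nhds 0)
        (nhds 0) := by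
      have h2 : Continuous (fun z : V => edist (hG.toLp G) ((DomAddAct.mk z) +ᵥ hG.toLp G)) :=
        continuous_const.edist hc
      have := h2.tendsto 0
      simpa using this
    refine h1.congr fun z => ?_
    rw [Lp.edist_def]
    exact (eLpNorm_congr_ae (Lp.coeFn_sub _ _)).symm
  refine ht.congr fun z => eLpNorm_congr_ae ?_
  have hmp : MeasurePreserving (fun x : V => z + x) ν ν := measurePreserving_add_left ν z
  filter_upwards [Lp.coeFn_sub (hG.toLp G) ((DomAddAct.mk z) +ᵥ hG.toLp G), hG.coeFn_toLp,
    Lp.coeFn_compMeasurePreserving (hG.toLp G) hmp,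
    hmp.quasiMeasurePreserving.ae_eq_comp hG.coeFn_toLp] with x h1 h2 h3 h4
  rw [h1, Pi.sub_apply, h2]
  congr 1
  exact h3.trans h4

theorem lintegral_kernel_lt_top {V : Type*} [NormedAddCommGroup V] [NormedSpace ℝ V]
    [FiniteDimensional ℝ V] [Nontrivial V] [MeasurableSpace V] [BorelSpace V] (ν : Measure V)
    [ν.IsAddHaarMeasure] {s p : ℝ} (hs0 : 0 < s) (hs1 : s < 1) (hp : 1 ≤ p) :
    ∫⁻ u : V, ENNReal.ofReal
      (min 1 (4 * ‖u‖) ^ p * (‖u‖ ^ ((Module.finrank ℝ V : ℝ) + s * p))⁻¹) ∂ν < ⊤ := by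
  set n := Module.finrank ℝ V with hn
  have hn1 : 1 ≤ n := Module.finrank_pos
  have hsp : 0 < s * p := by positivity
  let φ : ℝ → ℝ := fun r => min 1 (4 * r) ^ p * (r ^ ((n : ℝ) + s * p))⁻¹
  have hφm : Measurable φ := by fun_prop
  have hint : Integrable (fun u : V => φ ‖u‖) ν := by
    rw [integrable_fun_norm_addHaar ν (f := φ), ← Ioc_union_Ioi_eq_Ioi zero_le_one]
    have hpow : ∀ r : ℝ, 0 < r →
        r ^ (n - 1) * (r ^ ((n : ℝ) + s * p))⁻¹ = r ^ (-1 - s * p) := by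
      intro r hr
      rw [← Real.rpow_natCast, ← Real.rpow_neg hr.le, ← Real.rpow_add hr]
      congr 1
      push_cast [Nat.cast_sub hn1]; ring
    refine IntegrableOn.union ?_ ?_
    · have h1 : IntegrableOn (fun r : ℝ => (4 : ℝ) ^ p * r ^ (p - 1 - s * p)) (Ioc 0 1) := by
        have := (intervalIntegral.intervalIntegrable_rpow' (a := 0) (b := 1)
          (r := p - 1 - s * p) (by nlinarith)).const_mul ((4 : ℝ) ^ p)
        rwa [intervalIntegrable_iff_integrableOn_Ioc_of_le zero_le_one] at this
      refine h1.mono' (by fun_prop) ?_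
      filter_upwards [ae_restrict_mem measurableSet_Ioc] with r hr
      have hr0 := hr.1
      have h4 : 0 ≤ min 1 (4 * r) := le_min zero_le_one (by positivity)
      rw [smul_eq_mul, Real.norm_of_nonneg (by positivity)]
      calc r ^ (n - 1) * φ r = min 1 (4 * r) ^ p * (r ^ (n - 1) * (r ^ ((n : ℝ) + s * p))⁻¹) := by
            simp only [φ]; ring
        _ ≤ (4 * r) ^ p * r ^ (-1 - s * p) := by
            rw [hpow r hr0]
            gcongr
            exact min_le_right _ _
        _ = _ := by
            rw [Real.mul_rpow (by norm_num) hr0.le, mul_assoc, ← Real.rpow_add hr0]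
            congr 2; ring
    · have h1 : IntegrableOn (fun r : ℝ => r ^ (-1 - s * p)) (Ioi 1) :=
        integrableOn_Ioi_rpow_of_lt (by linarith) one_pos
      refine h1.mono' (by fun_prop) ?_
      filter_upwards [ae_restrict_mem measurableSet_Ioi] with r hr
      have hr0 : (0 : ℝ) < r := one_pos.trans hr
      have h4 : 0 ≤ min 1 (4 * r) := le_min zero_le_one (by positivity)
      rw [smul_eq_mul, Real.norm_of_nonneg (by positivity)]
      calc r ^ (n - 1) * φ r = min 1 (4 * r) ^ p * (r ^ (n - 1) * (r ^ ((n : ℝ) + s * p))⁻¹) := by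
            simp only [φ]; ring
        _ ≤ 1 ^ p * r ^ (-1 - s * p) := by
            rw [hpow r hr0]
            gcongr
            exact min_le_left _ _
        _ = _ := by simp
  exact hint.lintegral_lt_top

theorem lintegral_kernel_scale {V : Type*} [NormedAddCommGroup V] [NormedSpace ℝ V]
    [FiniteDimensional ℝ V] [MeasurableSpace V] [BorelSpace V] (ν : Measure V)
    [ν.IsAddHaarMeasure] (s p : ℝ) (x : V) {a : ℝ} (ha : 0 < a) :
    ∫⁻ y : V, ENNReal.ofReal
      (min 1 (4 * dist x y / a) ^ p * (dist x y ^ ((Module.finrank ℝ V : ℝ) + s * p))⁻¹) ∂ν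
    = ENNReal.ofReal (a ^ (-(s * p))) * ∫⁻ u : V, ENNReal.ofReal
      (min 1 (4 * ‖u‖) ^ p * (‖u‖ ^ ((Module.finrank ℝ V : ℝ) + s * p))⁻¹) ∂ν := by
  set n := Module.finrank ℝ V with hn
  let K : V → ℝ≥0∞ := fun u => ENNReal.ofReal
      (min 1 (4 * ‖u‖ / a) ^ p * (‖u‖ ^ ((n : ℝ) + s * p))⁻¹)
  have hK : Measurable K := by fun_prop
  have h1 : ∫⁻ y : V, ENNReal.ofReal
      (min 1 (4 * dist x y / a) ^ p * (dist x y ^ ((n : ℝ) + s * p))⁻¹) ∂ν = ∫⁻ u, K u ∂ν := by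
    rw [← lintegral_sub_left_eq_self K x]
    simp only [K, dist_eq_norm]
  have h2 : ∫⁻ u, K (a • u) ∂ν = ENNReal.ofReal ((a ^ n)⁻¹) * ∫⁻ u, K u ∂ν := by
    rw [← lintegral_map hK (measurable_const_smul a), Measure.map_addHaar_smul ν ha.ne',
      lintegral_smul_measure, abs_of_pos (by positivity), smul_eq_mul]
  have h3 : ∀ u, K (a • u) = ENNReal.ofReal (a ^ (-((n : ℝ) + s * p))) * ENNReal.ofReal
      (min 1 (4 * ‖u‖) ^ p * (‖u‖ ^ ((n : ℝ) + s * p))⁻¹) := by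
    intro u
    rw [← ENNReal.ofReal_mul (by positivity)]
    simp only [K]
    congr 1
    rw [norm_smul, Real.norm_of_nonneg ha.le, Real.mul_rpow ha.le (norm_nonneg u),
      Real.rpow_neg ha.le, mul_inv, show 4 * (a * ‖u‖) / a = 4 * ‖u‖ by field_simp]
    ring
  rw [h1]
  simp_rw [h3] at h2
  rw [lintegral_const_mul _ (by fun_prop)] at h2
  have h4 : ENNReal.ofReal (a ^ n) * ENNReal.ofReal ((a ^ n)⁻¹) = 1 := by
    rw [← ENNReal.ofReal_mul (by positivity), mul_inv_cancel₀ (by positivity), ENNReal.ofReal_one]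
  rw [← one_mul (∫⁻ u, K u ∂ν), ← h4, mul_assoc, ← h2, ← mul_assoc,
    ← ENNReal.ofReal_mul (by positivity), ← Real.rpow_natCast, ← Real.rpow_add ha]
  congr 3
  ring

theorem lintegral_ofReal_lt_top_of_tail {X : Type*} [MeasurableSpace X] {ν : Measure X}
    [IsFiniteMeasure ν] {F : X → ℝ} (hF : Measurable F) (hF0 : ∀ x, 0 ≤ F x) {a T : ℝ}
    (ha : 1 < a) (hT : 0 < T)
    (htail : ∀ t, T < t → ν {x | t ≤ F x} ≤ ENNReal.ofReal (t ^ (-a))) :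
    ∫⁻ x, ENNReal.ofReal (F x) ∂ν < ⊤ := by
  rw [lintegral_eq_lintegral_meas_le ν (Eventually.of_forall hF0) hF.aemeasurable,
    ← Ioc_union_Ioi_eq_Ioi hT.le]
  refine (lintegral_union_le _ _ _).trans_lt (ENNReal.add_lt_top.2 ⟨?_, ?_⟩)
  · calc _ ≤ ∫⁻ _ in Ioc 0 T, ν univ := lintegral_mono fun t => measure_mono (subset_univ _)
      _ < ⊤ := by
        rw [lintegral_const]
        exact ENNReal.mul_lt_top (measure_lt_top _ _) (by simp)
  · calc _ ≤ ∫⁻ t in Ioi T, ENNReal.ofReal (t ^ (-a)) :=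
          setLIntegral_mono' measurableSet_Ioi fun t ht => htail t ht
      _ < ⊤ := (integrableOn_Ioi_rpow_of_lt (by linarith) hT).lintegral_lt_top

section Boundary

variable {d : ℕ} {Ω : Set (Rd d)}

theorem continuous_distBd : Continuous (distBd Ω) := Metric.continuous_infDist_pt _

theorem measurable_distBd : Measurable (distBd Ω) := continuous_distBd.measurable

theorem distBd_nonneg (x : Rd d) : 0 ≤ distBd Ω x := Metric.infDist_nonneg

theorem distBd_le_distBd_add_dist (x y : Rd d) : distBd Ω x ≤ distBd Ω y + dist x y :=
  Metric.infDist_le_infDist_add_dist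

theorem abs_distBd_sub_le (x y : Rd d) : |distBd Ω x - distBd Ω y| ≤ dist x y := by
  have h1 := distBd_le_distBd_add_dist (Ω := Ω) x y
  have h2 := distBd_le_distBd_add_dist (Ω := Ω) y x
  rw [dist_comm] at h2
  rw [abs_le]
  constructor <;> linarith

theorem frontier_nonempty_of_bounded (hd : 0 < d) (hne : Ω.Nonempty)
    (hbdd : Bornology.IsBounded Ω) : (frontier Ω).Nonempty := by
  have : NeZero d := ⟨hd.ne'⟩
  rw [nonempty_frontier_iff]
  refine ⟨hne, fun h => ?_⟩
  rw [h] at hbdd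
  exact NormedSpace.unbounded_univ ℝ (Rd d) hbdd

theorem distBd_pos (hopen : IsOpen Ω) (hfr : (frontier Ω).Nonempty) {x : Rd d} (hx : x ∈ Ω) :
    0 < distBd Ω x := by
  refine (isClosed_frontier.notMem_iff_infDist_pos hfr).1 fun h => ?_
  rw [hopen.frontier_eq] at h
  exact h.2 hx

theorem mem_of_dist_lt_distBd (hopen : IsOpen Ω) {x y : Rd d} (hx : x ∈ Ω)
    (hxy : dist x y < distBd Ω x) : y ∈ Ω := by
  have hpre : IsPreconnected (ball x (distBd Ω x)) := (convex_ball _ _).isPreconnected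
  have hsub : ball x (distBd Ω x) ⊆ Ω ∪ (closure Ω)ᶜ := by
    intro z hz
    by_contra hc
    rw [mem_union, not_or, mem_compl_iff, not_not] at hc
    have hzf : z ∈ frontier Ω := by rw [hopen.frontier_eq]; exact ⟨hc.2, hc.1⟩
    have hle : distBd Ω x ≤ dist x z := Metric.infDist_le_dist_of_mem hzf
    rw [mem_ball, dist_comm] at hz
    linarith
  refine hpre.subset_left_of_subset_union hopen isClosed_closure.isOpen_compl
    (disjoint_compl_right.mono_left subset_closure) hsub
    ⟨x, mem_ball_self (dist_nonneg.trans_lt hxy), hx⟩ ?_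
  rwa [mem_ball, dist_comm]

theorem isCompact_distBd_ge (hbdd : Bornology.IsBounded Ω) (hopen : IsOpen Ω) {δ : ℝ}
    (hδ : 0 < δ) : IsCompact {x | x ∈ Ω ∧ δ ≤ distBd Ω x} := by
  have heq : {x | x ∈ Ω ∧ δ ≤ distBd Ω x} = closure Ω ∩ {x | δ ≤ distBd Ω x} := by
    ext x
    refine ⟨fun h => ⟨subset_closure h.1, h.2⟩, fun h => ⟨?_, h.2⟩⟩
    by_contra hx
    have hf : x ∈ frontier Ω := by rw [hopen.frontier_eq]; exact ⟨h.1, hx⟩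
    have h0 : distBd Ω x = 0 := Metric.infDist_zero_of_mem hf
    have := h.2
    simp only [mem_ofPred_eq, h0] at this
    linarith
  rw [heq]
  exact hbdd.isCompact_closure.inter_right (isClosed_le continuous_const continuous_distBd)

theorem exists_distBd_le (hbdd : Bornology.IsBounded Ω) :
    ∃ D : ℝ, 0 < D ∧ ∀ x ∈ Ω, distBd Ω x ≤ D := by
  obtain ⟨D, hD⟩ := (hbdd.isCompact_closure.image continuous_distBd).bddAbove
  exact ⟨max D 1, by positivity, fun x hx =>
    (hD ⟨x, subset_closure hx, rfl⟩).trans (le_max_left _ _)⟩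

theorem upperMinkDim_nonneg (E : Set (Rd d)) : 0 ≤ upperMinkDim E :=
  Real.sInf_nonneg fun _ ht => ht.1

theorem exists_volume_cthickening_le {E : Set (Rd d)} (hE : Bornology.IsBounded E) {t₀ : ℝ}
    (ht₀ : upperMinkDim E < t₀) :
    ∃ t < t₀, ∃ r₀ : ℝ, 0 < r₀ ∧ ∀ r, 0 < r → r < r₀ →
      volume (cthickening r E) ≤ ENNReal.ofReal (r ^ ((d : ℝ) - t)) := by
  have hne : {t : ℝ | 0 ≤ t ∧ Filter.limsup (fun r : ℝ =>
        volume (Metric.cthickening r E) * ENNReal.ofReal (r ^ (t - (d : ℝ))))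
      (nhdsWithin 0 (Set.Ioi 0)) = 0}.Nonempty := by
    refine ⟨(d : ℝ) + 1, by positivity, Tendsto.limsup_eq ?_⟩
    have hfin : volume (cthickening 1 E) ≠ ⊤ := hE.cthickening.measure_lt_top.ne
    have h1 : Tendsto (fun r : ℝ => volume (cthickening 1 E) * ENNReal.ofReal r)
        (nhdsWithin 0 (Set.Ioi 0)) (nhds 0) := by
      have h2 : Tendsto (fun r : ℝ => ENNReal.ofReal r) (nhdsWithin 0 (Set.Ioi 0)) (nhds 0) := by
        have := (ENNReal.continuous_ofReal.tendsto 0).mono_left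
          (nhdsWithin_le_nhds (s := Set.Ioi (0 : ℝ)))
        simpa using this
      simpa using ENNReal.Tendsto.const_mul h2 (Or.inr hfin)
    refine tendsto_of_tendsto_of_tendsto_of_le_of_le' tendsto_const_nhds h1
      (Eventually.of_forall fun _ => bot_le) ?_
    filter_upwards [Ioo_mem_nhdsGT (zero_lt_one (α := ℝ))] with r hr
    rw [add_sub_cancel_left, Real.rpow_one]
    gcongr
    exact cthickening_mono hr.2.le _
  obtain ⟨t, ⟨-, ht⟩, htlt⟩ := exists_lt_of_csInf_lt hne ht₀
  refine ⟨t, htlt, ?_⟩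
  have hev := eventually_lt_of_limsup_lt (ht.trans_lt zero_lt_one)
  obtain ⟨r₀, hr₀, hsub⟩ := mem_nhdsGT_iff_exists_Ioo_subset.1 hev
  refine ⟨r₀, hr₀, fun r hr hr' => ?_⟩
  have h1 : volume (cthickening r E) * ENNReal.ofReal (r ^ (t - (d : ℝ))) < 1 := hsub ⟨hr, hr'⟩
  have h2 : ENNReal.ofReal (r ^ (t - (d : ℝ))) * ENNReal.ofReal (r ^ ((d : ℝ) - t)) = 1 := by
    rw [← ENNReal.ofReal_mul (by positivity), ← Real.rpow_add hr]
    simp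
  calc volume (cthickening r E) = volume (cthickening r E) *
        (ENNReal.ofReal (r ^ (t - (d : ℝ))) * ENNReal.ofReal (r ^ ((d : ℝ) - t))) := by
        rw [h2, mul_one]
    _ = volume (cthickening r E) *
        ENNReal.ofReal (r ^ (t - (d : ℝ))) * ENNReal.ofReal (r ^ ((d : ℝ) - t)) := by ring
    _ ≤ 1 * ENNReal.ofReal (r ^ ((d : ℝ) - t)) := by gcongr
    _ = _ := one_mul _

theorem lintegral_distBd_rpow_lt_top (hbdd : Bornology.IsBounded Ω)
    (hfr : (frontier Ω).Nonempty) {q : ℝ} (hq0 : 0 ≤ q)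
    (hq : q < (d : ℝ) - upperMinkDim (frontier Ω)) :
    ∫⁻ x in Ω, ENNReal.ofReal (distBd Ω x ^ (-q)) < ⊤ := by
  have : IsFiniteMeasure (volume.restrict Ω) := ⟨by simpa using hbdd.measure_lt_top⟩
  rcases hq0.eq_or_lt with rfl | hq0
  · simpa using hbdd.measure_lt_top
  have hfb : Bornology.IsBounded (frontier Ω) := hbdd.closure.subset frontier_subset_closure
  obtain ⟨t, ht, r₀, hr₀, hr⟩ := exists_volume_cthickening_le hfb (t₀ := (d : ℝ) - q) (by linarith)
  refine lintegral_ofReal_lt_top_of_tail (a := ((d : ℝ) - t) / q) (T := r₀ ^ (-q))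
    (measurable_distBd.pow_const _) (fun x => Real.rpow_nonneg (distBd_nonneg x) _)
    ((one_lt_div hq0).2 (by linarith)) (by positivity) fun τ hτ => ?_
  have hτ0 : 0 < τ := lt_trans (by positivity) hτ
  have hlt : τ ^ (-q⁻¹) < r₀ := by
    have := Real.rpow_lt_rpow_of_neg (z := -q⁻¹) (by positivity) hτ (by simpa using hq0)
    rwa [← Real.rpow_mul hr₀.le, neg_mul_neg, mul_inv_cancel₀ hq0.ne', Real.rpow_one] at this
  have hbound := hr (τ ^ (-q⁻¹)) (by positivity) hlt
  rw [← Real.rpow_mul hτ0.le] at hbound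
  refine ((Measure.restrict_apply_le _ _).trans (measure_mono fun x hx => ?_)).trans
    (hbound.trans_eq (by congr 2; field_simp))
  have hx' : τ ≤ distBd Ω x ^ (-q) := hx
  have hle : distBd Ω x ≤ τ ^ (-q⁻¹) := by
    rcases (distBd_nonneg (Ω := Ω) x).eq_or_lt with h0 | h0
    · rw [← h0]; positivity
    · have := Real.rpow_le_rpow_of_nonpos hτ0 hx' (z := -q⁻¹) (by simpa using hq0.le)
      rwa [← Real.rpow_mul h0.le, neg_mul_neg, mul_inv_cancel₀ hq0.ne', Real.rpow_one] at this
  rw [mem_cthickening_iff]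
  rw [distBd, Metric.infDist] at hle
  rw [← ENNReal.ofReal_toReal (Metric.infEDist_ne_top hfr (x := x))]
  exact ENNReal.ofReal_le_ofReal hle

end Boundary

section Seminorm

variable {d : ℕ} {Ω : Set (Rd d)} {s p α β : ℝ}

/-- The weight `|x - y|^{-d-sp} d_Ω(y)^{-β} d_Ω(x)^{-α}` of the Gagliardo seminorm. -/
noncomputable def gagKernel (Ω : Set (Rd d)) (s p α β : ℝ) (z : Rd d × Rd d) : ℝ :=
  (dist z.1 z.2 ^ ((d : ℝ) + s * p))⁻¹ * distBd Ω z.2 ^ (-β) * distBd Ω z.1 ^ (-α)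

/-- The measure on `Ω × Ω` for which the Gagliardo seminorm is an `L^p` norm. -/
noncomputable def gagMeasure (Ω : Set (Rd d)) (s p α β : ℝ) : Measure (Rd d × Rd d) :=
  ((volume.restrict Ω).prod (volume.restrict Ω)).withDensity
    fun z => ENNReal.ofReal (gagKernel Ω s p α β z)

/-- The increment `f(x) - f(y)` as a function of the pair `(x, y)`. -/
def incr (f : Rd d → ℝ) (z : Rd d × Rd d) : ℝ := f z.1 - f z.2

instance : SFinite (gagMeasure Ω s p α β) := by
  unfold gagMeasure; infer_instance

theorem measurable_incr {f : Rd d → ℝ} (hf : Measurable f) : Measurable (incr f) :=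
  (hf.comp measurable_fst).sub (hf.comp measurable_snd)

theorem measurable_gagKernel : Measurable (gagKernel Ω s p α β) := by
  have h1 : Measurable fun z : Rd d × Rd d => distBd Ω z.1 := measurable_distBd.comp measurable_fst
  have h2 : Measurable fun z : Rd d × Rd d => distBd Ω z.2 := measurable_distBd.comp measurable_snd
  unfold gagKernel
  fun_prop

theorem gagKernel_nonneg (z : Rd d × Rd d) : 0 ≤ gagKernel Ω s p α β z := by
  have h1 := distBd_nonneg (Ω := Ω) z.1
  have h2 := distBd_nonneg (Ω := Ω) z.2
  unfold gagKernel
  positivity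

theorem lintegral_gagMeasure {F : Rd d × Rd d → ℝ≥0∞} (hF : Measurable F) :
    ∫⁻ z, F z ∂gagMeasure Ω s p α β = ∫⁻ z, ENNReal.ofReal (gagKernel Ω s p α β z) * F z
      ∂((volume.restrict Ω).prod (volume.restrict Ω)) := by
  rw [gagMeasure, lintegral_withDensity_eq_lintegral_mul _ measurable_gagKernel.ennreal_ofReal hF]
  rfl

theorem ae_gagMeasure_mem (hopen : IsOpen Ω) :
    ∀ᵐ z ∂gagMeasure Ω s p α β, z.1 ∈ Ω ∧ z.2 ∈ Ω := by
  refine (withDensity_absolutelyContinuous _ _).ae_le ?_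
  rw [Measure.prod_restrict]
  filter_upwards [ae_restrict_mem (hopen.measurableSet.prod hopen.measurableSet)] with z hz
  exact hz

theorem gagP_eq_lintegral (hp : 0 < p) {f : Rd d → ℝ} (hf : Measurable f) :
    gagP Ω s p α β f = ∫⁻ z, ‖incr f z‖ₑ ^ p ∂gagMeasure Ω s p α β := by
  have hm := (measurable_incr hf).enorm.pow_const p
  have hm' : Measurable fun z => ENNReal.ofReal (gagKernel Ω s p α β z) * ‖incr f z‖ₑ ^ p :=
    measurable_gagKernel.ennreal_ofReal.mul hm
  rw [lintegral_gagMeasure hm, lintegral_prod _ hm'.aemeasurable, gagP]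
  refine lintegral_congr fun x => lintegral_congr fun y => ?_
  rw [Real.enorm_eq_ofReal_abs, ENNReal.ofReal_rpow_of_nonneg (abs_nonneg _) hp.le,
    ← ENNReal.ofReal_mul (gagKernel_nonneg _)]
  congr 1
  simp only [gagKernel, incr]
  ring

theorem gagSemi_eq_eLpNorm (hp : 0 < p) {f : Rd d → ℝ} (hf : Measurable f) :
    gagSemi Ω s p α β f = eLpNorm (incr f) (ENNReal.ofReal p) (gagMeasure Ω s p α β) := by
  rw [gagSemi, gagP_eq_lintegral hp hf, eLpNorm_eq_lintegral_rpow_enorm_toReal (by simpa using hp)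
    ENNReal.ofReal_ne_top, ENNReal.toReal_ofReal hp.le]

theorem gagP_congr {f g : Rd d → ℝ} (hfg : f =ᵐ[volume.restrict Ω] g) :
    gagP Ω s p α β f = gagP Ω s p α β g := by
  refine lintegral_congr_ae ?_
  filter_upwards [hfg] with x hx
  refine lintegral_congr_ae ?_
  filter_upwards [hfg] with y hy
  rw [hx, hy]

theorem wNorm_congr {f g : Rd d → ℝ} (hfg : f =ᵐ[volume.restrict Ω] g) :
    wNorm Ω s p α β f = wNorm Ω s p α β g := by
  rw [wNorm, wNorm, gagSemi, gagSemi, gagP_congr hfg, eLpNorm_congr_ae hfg]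

theorem memW_congr {f g : Rd d → ℝ} (hfg : f =ᵐ[volume.restrict Ω] g) :
    memW Ω s p α β f ↔ memW Ω s p α β g := by
  rw [memW, memW, gagP_congr hfg, memLp_congr_ae hfg]

theorem memW_iff_memLp (hp : 0 < p) {f : Rd d → ℝ} (hf : Measurable f) :
    memW Ω s p α β f ↔ MemLp f (ENNReal.ofReal p) (volume.restrict Ω) ∧
      MemLp (incr f) (ENNReal.ofReal p) (gagMeasure Ω s p α β) := by
  rw [memW]
  refine and_congr_right fun _ => ?_
  rw [MemLp, ← gagSemi_eq_eLpNorm hp hf, gagSemi]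
  refine ⟨fun h => ⟨(measurable_incr hf).aestronglyMeasurable,
    ENNReal.rpow_lt_top_of_nonneg (by positivity) h.ne⟩, fun h => ?_⟩
  exact (ENNReal.rpow_lt_top_iff_of_pos (by positivity)).1 h.2

/-- A uniform bound for the increments of the cutoff functions near the boundary. -/
noncomputable def cutoffBound (Ω : Set (Rd d)) (z : Rd d × Rd d) : ℝ :=
  min 1 (4 * dist z.1 z.2 / max (distBd Ω z.1) (distBd Ω z.2))

theorem measurable_cutoffBound : Measurable (cutoffBound Ω) := by
  have h1 : Measurable fun z : Rd d × Rd d => distBd Ω z.1 := measurable_distBd.comp measurable_fst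
  have h2 : Measurable fun z : Rd d × Rd d => distBd Ω z.2 := measurable_distBd.comp measurable_snd
  unfold cutoffBound
  fun_prop

theorem memLp_cutoffBound (hd : 0 < d) (hopen : IsOpen Ω) (hfr : (frontier Ω).Nonempty)
    (hs0 : 0 < s) (hs1 : s < 1) (hp : 1 ≤ p) (hα0 : 0 ≤ α) (hβ0 : 0 ≤ β)
    (hint : ∫⁻ x in Ω, ENNReal.ofReal (distBd Ω x ^ (-(s * p + α + β))) < ⊤) :
    MemLp (cutoffBound Ω) (ENNReal.ofReal p) (gagMeasure Ω s p α β) := by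
  have hp' : 0 < p := by linarith
  have : NeZero d := ⟨hd.ne'⟩
  have hm1 : Measurable fun z : Rd d × Rd d => distBd Ω z.1 := measurable_distBd.comp measurable_fst
  refine ⟨measurable_cutoffBound.aestronglyMeasurable, ?_⟩
  rw [eLpNorm_eq_lintegral_rpow_enorm_toReal (by simpa using hp') ENNReal.ofReal_ne_top,
    ENNReal.toReal_ofReal hp'.le, ENNReal.rpow_lt_top_iff_of_pos (by positivity),
    lintegral_gagMeasure (measurable_cutoffBound.enorm.pow_const p)]
  set μ := volume.restrict Ω with hμ
  let A : Rd d × Rd d → ℝ≥0∞ := fun z => ENNReal.ofReal (distBd Ω z.1 ^ (-(α + β))) *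
    ENNReal.ofReal (min 1 (4 * dist z.1 z.2 / distBd Ω z.1) ^ p *
      (dist z.1 z.2 ^ ((d : ℝ) + s * p))⁻¹)
  have hA : Measurable A := by
    simp only [A]
    fun_prop
  have hbound : ∀ᵐ z ∂μ.prod μ, ENNReal.ofReal (gagKernel Ω s p α β z) * ‖cutoffBound Ω z‖ₑ ^ p
      ≤ A z + A z.swap := by
    rw [hμ, Measure.prod_restrict]
    filter_upwards [ae_restrict_mem (hopen.measurableSet.prod hopen.measurableSet)] with z hz
    obtain ⟨x, y⟩ := z
    have hx : 0 < distBd Ω x := distBd_pos hopen hfr hz.1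
    have hy : 0 < distBd Ω y := distBd_pos hopen hfr hz.2
    have hmax : 0 < max (distBd Ω x) (distBd Ω y) := lt_max_of_lt_left hx
    have hc0 : 0 ≤ cutoffBound Ω (x, y) := by
      unfold cutoffBound
      positivity
    rw [Real.enorm_eq_ofReal_abs, ENNReal.ofReal_rpow_of_nonneg (abs_nonneg _) hp'.le,
      ← ENNReal.ofReal_mul (gagKernel_nonneg _), abs_of_nonneg hc0]
    have hle1 : cutoffBound Ω (x, y) ≤ min 1 (4 * dist x y / distBd Ω x) := by
      simp only [cutoffBound]
      gcongr
      exact le_max_left _ _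
    have hle2 : cutoffBound Ω (x, y) ≤ min 1 (4 * dist x y / distBd Ω y) := by
      simp only [cutoffBound]
      gcongr
      exact le_max_right _ _
    rcases le_total (distBd Ω x) (distBd Ω y) with hxy | hxy
    · refine le_trans ?_ (le_add_right le_rfl)
      simp only [A]
      rw [← ENNReal.ofReal_mul (by positivity)]
      refine ENNReal.ofReal_le_ofReal ?_
      simp only [gagKernel]
      calc _ = distBd Ω y ^ (-β) * distBd Ω x ^ (-α) *
            (cutoffBound Ω (x, y) ^ p * (dist x y ^ ((d : ℝ) + s * p))⁻¹) := by ring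
        _ ≤ distBd Ω x ^ (-β) * distBd Ω x ^ (-α) *
            (min 1 (4 * dist x y / distBd Ω x) ^ p * (dist x y ^ ((d : ℝ) + s * p))⁻¹) := by
            have := Real.rpow_le_rpow_of_nonpos hx hxy (z := -β) (by linarith)
            gcongr
        _ = _ := by
            rw [← Real.rpow_add hx]
            congr 2
            ring
    · refine le_trans ?_ (le_add_left le_rfl)
      simp only [A, Prod.swap]
      rw [← ENNReal.ofReal_mul (by positivity)]
      refine ENNReal.ofReal_le_ofReal ?_
      simp only [gagKernel]
      rw [dist_comm y x]
      calc _ = distBd Ω y ^ (-β) * distBd Ω x ^ (-α) *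
            (cutoffBound Ω (x, y) ^ p * (dist x y ^ ((d : ℝ) + s * p))⁻¹) := by ring
        _ ≤ distBd Ω y ^ (-β) * distBd Ω y ^ (-α) *
            (min 1 (4 * dist x y / distBd Ω y) ^ p * (dist x y ^ ((d : ℝ) + s * p))⁻¹) := by
            have := Real.rpow_le_rpow_of_nonpos hy hxy (z := -α) (by linarith)
            gcongr
        _ = _ := by
            rw [← Real.rpow_add hy]
            congr 2
            ring
  have hAint : ∫⁻ z, A z ∂μ.prod μ < ⊤ := by
    rw [lintegral_prod _ hA.aemeasurable]
    have hK := lintegral_kernel_lt_top (volume : Measure (Rd d)) hs0 hs1 hp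
    set K := ∫⁻ u : Rd d, ENNReal.ofReal
      (min 1 (4 * ‖u‖) ^ p * (‖u‖ ^ ((Module.finrank ℝ (Rd d) : ℝ) + s * p))⁻¹) with hKdef
    have hin : ∀ᵐ x ∂μ, ∫⁻ y, A (x, y) ∂μ ≤
        ENNReal.ofReal (distBd Ω x ^ (-(s * p + α + β))) * K := by
      filter_upwards [ae_restrict_mem hopen.measurableSet] with x hx
      have hx0 : 0 < distBd Ω x := distBd_pos hopen hfr hx
      have hsc := lintegral_kernel_scale (volume : Measure (Rd d)) s p x hx0
      rw [← hKdef, finrank_euclideanSpace_fin] at hsc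
      simp only [A]
      rw [lintegral_const_mul _ (by fun_prop)]
      calc _ ≤ ENNReal.ofReal (distBd Ω x ^ (-(α + β))) *
            (ENNReal.ofReal (distBd Ω x ^ (-(s * p))) * K) := by
            rw [← hsc]
            gcongr
            exact Measure.restrict_le_self
        _ = _ := by
            rw [← mul_assoc, ← ENNReal.ofReal_mul (by positivity), ← Real.rpow_add hx0]
            congr 3
            ring
    calc _ ≤ ∫⁻ x, ENNReal.ofReal (distBd Ω x ^ (-(s * p + α + β))) * K ∂μ :=
          lintegral_mono_ae hin
      _ = (∫⁻ x, ENNReal.ofReal (distBd Ω x ^ (-(s * p + α + β))) ∂μ) * K :=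
          lintegral_mul_const _ (measurable_distBd.pow_const _).ennreal_ofReal
      _ < ⊤ := ENNReal.mul_lt_top hint hK
  calc _ ≤ ∫⁻ z, A z + A z.swap ∂μ.prod μ := lintegral_mono_ae hbound
    _ = ∫⁻ z, A z ∂μ.prod μ + ∫⁻ z, A z.swap ∂μ.prod μ := lintegral_add_left hA _
    _ < ⊤ := by
      rw [lintegral_prod_swap]
      exact ENNReal.add_lt_top.2 ⟨hAint, hAint⟩

/-- A Lipschitz function equal to `1` where `n d_Ω ≤ 1` and to `0` where `n d_Ω ≥ 2`. -/
noncomputable def cutoff (Ω : Set (Rd d)) (n : ℕ) (x : Rd d) : ℝ :=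
  max 0 (min 1 (2 - n * distBd Ω x))

theorem measurable_cutoff (n : ℕ) : Measurable (cutoff Ω n) := by
  have := measurable_distBd (Ω := Ω)
  unfold cutoff
  fun_prop

theorem cutoff_nonneg (n : ℕ) (x : Rd d) : 0 ≤ cutoff Ω n x := le_max_left _ _

theorem cutoff_le_one (n : ℕ) (x : Rd d) : cutoff Ω n x ≤ 1 :=
  max_le zero_le_one (min_le_left _ _)

theorem cutoff_eq_zero {n : ℕ} {x : Rd d} (h : 2 ≤ n * distBd Ω x) : cutoff Ω n x = 0 := by
  unfold cutoff
  exact max_eq_left ((min_le_right _ _).trans (by linarith))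

theorem cutoff_eq_one {n : ℕ} {x : Rd d} (h : n * distBd Ω x ≤ 1) : cutoff Ω n x = 1 := by
  unfold cutoff
  rw [min_eq_left (by linarith)]
  simp

theorem tendsto_cutoff (hopen : IsOpen Ω) (hfr : (frontier Ω).Nonempty) {x : Rd d}
    (hx : x ∈ Ω) : Tendsto (fun n => cutoff Ω n x) atTop (nhds 0) := by
  have h0 := distBd_pos hopen hfr hx
  refine tendsto_const_nhds.congr' ?_
  have h1 : Tendsto (fun n : ℕ => (n : ℝ) * distBd Ω x) atTop atTop :=
    tendsto_natCast_atTop_atTop.atTop_mul_const h0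
  filter_upwards [h1.eventually_ge_atTop 2] with n hn
  exact (cutoff_eq_zero hn).symm

theorem abs_cutoff_sub_le (n : ℕ) (x y : Rd d) :
    |cutoff Ω n x - cutoff Ω n y| ≤ n * dist x y := by
  have h1 : |cutoff Ω n x - cutoff Ω n y| ≤ |(2 - n * distBd Ω x) - (2 - n * distBd Ω y)| := by
    unfold cutoff
    refine (abs_max_sub_max_le_max _ _ _ _).trans (max_le (by simp) ?_)
    exact (abs_min_sub_min_le_max _ _ _ _).trans (max_le (by simp) le_rfl)
  refine h1.trans ?_
  rw [show (2 - n * distBd Ω x) - (2 - n * distBd Ω y) = n * (distBd Ω y - distBd Ω x) by ring,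
    abs_mul, Nat.abs_cast, abs_sub_comm]
  gcongr
  exact abs_distBd_sub_le x y

theorem abs_cutoff_sub_mul_distBd_le (n : ℕ) (x y : Rd d) :
    |cutoff Ω n x - cutoff Ω n y| * distBd Ω x ≤ 4 * dist x y := by
  have hx := distBd_nonneg (Ω := Ω) x
  rcases le_total (n * distBd Ω x) 4 with h4 | h4
  · calc _ ≤ n * dist x y * distBd Ω x := by gcongr; exact abs_cutoff_sub_le n x y
      _ = (n * distBd Ω x) * dist x y := by ring
      _ ≤ _ := by gcongr
  · have h0 : cutoff Ω n x = 0 := cutoff_eq_zero (by linarith)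
    rcases le_total 2 (n * distBd Ω y) with h2 | h2
    · rw [h0, cutoff_eq_zero h2]
      simp
    · have hle := distBd_le_distBd_add_dist (Ω := Ω) x y
      have hn : (0 : ℝ) < n := by
        by_contra hn
        have : (n : ℝ) = 0 := le_antisymm (not_lt.1 hn) (Nat.cast_nonneg n)
        rw [this] at h4
        linarith
      have hxy : distBd Ω x ≤ 2 * dist x y := by
        have : n * distBd Ω y ≤ n * (distBd Ω x / 2) := by linarith
        have := le_of_mul_le_mul_left this hn
        linarith
      have h1 : |cutoff Ω n x - cutoff Ω n y| ≤ 1 := by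
        rw [h0, zero_sub, abs_neg, abs_of_nonneg (cutoff_nonneg _ _)]
        exact cutoff_le_one _ _
      calc _ ≤ 1 * distBd Ω x := by gcongr
        _ ≤ _ := by linarith [dist_nonneg (x := x) (y := y)]

theorem abs_incr_cutoff_le (hopen : IsOpen Ω) (hfr : (frontier Ω).Nonempty) (n : ℕ)
    {z : Rd d × Rd d} (hz : z.1 ∈ Ω) : |incr (cutoff Ω n) z| ≤ cutoffBound Ω z := by
  have hx := distBd_pos hopen hfr hz
  refine le_min ?_ ?_
  · have := cutoff_nonneg (Ω := Ω) n z.1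
    have := cutoff_nonneg (Ω := Ω) n z.2
    have := cutoff_le_one (Ω := Ω) n z.1
    have := cutoff_le_one (Ω := Ω) n z.2
    rw [incr, abs_le]
    constructor <;> linarith
  · rw [le_div_iff₀ (lt_max_of_lt_left hx)]
    rcases le_total (distBd Ω z.1) (distBd Ω z.2) with h | h
    · rw [max_eq_right h, incr, abs_sub_comm, dist_comm]
      exact abs_cutoff_sub_mul_distBd_le n z.2 z.1
    · rw [max_eq_left h]
      exact abs_cutoff_sub_mul_distBd_le n z.1 z.2

end Seminorm

section Approximation

variable {d : ℕ} {Ω : Set (Rd d)} {s p α β : ℝ}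

theorem wNorm_eq_eLpNorm_add (hp : 0 < p) {f : Rd d → ℝ} (hf : Measurable f) :
    wNorm Ω s p α β f = eLpNorm f (ENNReal.ofReal p) (volume.restrict Ω) +
      eLpNorm (incr f) (ENNReal.ofReal p) (gagMeasure Ω s p α β) := by
  rw [wNorm, gagSemi_eq_eLpNorm hp hf]

theorem wNorm_add_le (hp : 1 ≤ p) {f g : Rd d → ℝ} (hf : Measurable f) (hg : Measurable g) :
    wNorm Ω s p α β (fun x => f x + g x) ≤ wNorm Ω s p α β f + wNorm Ω s p α β g := by
  have hp' : 0 < p := by linarith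
  have h1 : (1 : ℝ≥0∞) ≤ ENNReal.ofReal p := by simpa using hp
  have hm : Measurable fun x => f x + g x := hf.add hg
  rw [wNorm_eq_eLpNorm_add hp' hf, wNorm_eq_eLpNorm_add hp' hg,
    wNorm_eq_eLpNorm_add hp' hm, add_add_add_comm]
  have hincr : incr (fun x => f x + g x) = incr f + incr g := by
    ext z
    simp only [incr, Pi.add_apply]
    ring
  rw [hincr]
  exact add_le_add (eLpNorm_add_le hf.aestronglyMeasurable hg.aestronglyMeasurable h1)
    (eLpNorm_add_le (measurable_incr hf).aestronglyMeasurable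
      (measurable_incr hg).aestronglyMeasurable h1)

/-- Truncation of a real number at height `N`. -/
noncomputable def trunc (N : ℕ) (t : ℝ) : ℝ := max (-N) (min t N)

theorem measurable_trunc (N : ℕ) : Measurable (trunc N) := by
  unfold trunc
  fun_prop

theorem abs_trunc_le (N : ℕ) (t : ℝ) : |trunc N t| ≤ N := by
  have hN : (0 : ℝ) ≤ N := Nat.cast_nonneg N
  rw [abs_le]
  exact ⟨le_max_left _ _, max_le (by linarith) (min_le_right _ _)⟩

theorem trunc_eq_self {N : ℕ} {t : ℝ} (h : |t| ≤ N) : trunc N t = t := by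
  rw [abs_le] at h
  rw [trunc, min_eq_left h.2, max_eq_right h.1]

theorem abs_trunc_sub_trunc_le (N : ℕ) (a b : ℝ) : |trunc N a - trunc N b| ≤ |a - b| := by
  refine (abs_max_sub_max_le_max _ _ _ _).trans (max_le (by simp) ?_)
  exact (abs_min_sub_min_le_max _ _ _ _).trans (max_le le_rfl (by simp))

theorem abs_sub_trunc_sub_le (N : ℕ) (a b : ℝ) :
    |(a - trunc N a) - (b - trunc N b)| ≤ |a - b| := by
  wlog hab : b ≤ a generalizing a b
  · rw [abs_sub_comm, abs_sub_comm a]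
    exact this b a (le_of_not_ge hab)
  have h1 : trunc N b ≤ trunc N a := by unfold trunc; gcongr
  have h2 := abs_trunc_sub_trunc_le N a b
  rw [abs_of_nonneg (sub_nonneg.2 h1), abs_of_nonneg (sub_nonneg.2 hab)] at h2
  rw [abs_of_nonneg (sub_nonneg.2 hab), abs_le]
  constructor <;> linarith

theorem trunc_zero (N : ℕ) : trunc N 0 = 0 := trunc_eq_self (by simp)

theorem tendsto_trunc (t : ℝ) : Tendsto (fun N => trunc N t) atTop (nhds t) := by
  refine tendsto_const_nhds.congr' ?_
  filter_upwards [tendsto_natCast_atTop_atTop.eventually_ge_atTop |t|] with N hN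
  exact (trunc_eq_self hN).symm

theorem tendsto_wNorm_sub_trunc (hp : 0 < p) {f : Rd d → ℝ} (hf : Measurable f)
    (hfW : memW Ω s p α β f) :
    Tendsto (fun N => wNorm Ω s p α β (fun x => f x - trunc N (f x))) atTop (nhds 0) := by
  rw [memW_iff_memLp hp hf] at hfW
  have hm : ∀ N, Measurable fun x => f x - trunc N (f x) :=
    fun N => hf.sub ((measurable_trunc N).comp hf)
  simp only [fun N => wNorm_eq_eLpNorm_add (Ω := Ω) (s := s) (α := α) (β := β) hp (hm N)]
  have hlim : ∀ x, Tendsto (fun N => f x - trunc N (f x)) atTop (nhds 0) := fun x => by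
    simpa using (tendsto_const_nhds (x := f x)).sub (tendsto_trunc (f x))
  rw [← add_zero (0 : ℝ≥0∞)]
  refine Tendsto.add ?_ ?_
  · refine tendsto_eLpNorm_zero_of_dominated hp (fun N => (hm N).aestronglyMeasurable)
      hfW.1.abs (fun N => Eventually.of_forall fun x => ?_) (Eventually.of_forall hlim)
    simpa [trunc_zero] using abs_sub_trunc_sub_le N (f x) 0
  · refine tendsto_eLpNorm_zero_of_dominated hp
      (fun N => (measurable_incr (hm N)).aestronglyMeasurable)
      hfW.2.abs (fun N => Eventually.of_forall fun z => ?_) (Eventually.of_forall fun z => ?_)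
    · exact abs_sub_trunc_sub_le N (f z.1) (f z.2)
    · simpa [incr] using (hlim z.1).sub (hlim z.2)

theorem memW_trunc (hp : 0 < p) {f : Rd d → ℝ} (hf : Measurable f)
    (hfW : memW Ω s p α β f) (N : ℕ) : memW Ω s p α β (fun x => trunc N (f x)) := by
  have hm : Measurable fun x => trunc N (f x) := (measurable_trunc N).comp hf
  rw [memW_iff_memLp hp hf] at hfW
  rw [memW_iff_memLp hp hm]
  refine ⟨hfW.1.mono hm.aestronglyMeasurable (Eventually.of_forall fun x => ?_),
    hfW.2.mono (measurable_incr hm).aestronglyMeasurable (Eventually.of_forall fun z => ?_)⟩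
  · simpa [trunc_zero] using abs_trunc_sub_trunc_le N (f x) 0
  · exact abs_trunc_sub_trunc_le N (f z.1) (f z.2)

theorem abs_incr_mul_le {f u : Rd d → ℝ} {N B : ℝ} {z : Rd d × Rd d} (hf : |f z.2| ≤ N)
    (hu : |u z.1| ≤ 1) (hB : |incr u z| ≤ B) :
    |incr (fun x => f x * u x) z| ≤ |incr f z| + N * B := by
  have hN : 0 ≤ N := (abs_nonneg _).trans hf
  have : incr (fun x => f x * u x) z = incr f z * u z.1 + f z.2 * incr u z := by
    simp only [incr]
    ring
  rw [this]
  refine (abs_add_le _ _).trans ?_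
  rw [abs_mul, abs_mul]
  gcongr
  exact mul_le_of_le_one_right (abs_nonneg _) hu

theorem memW_mul (hp : 0 < p) (hopen : IsOpen Ω)
    (hM : MemLp (cutoffBound Ω) (ENNReal.ofReal p) (gagMeasure Ω s p α β))
    {f u : Rd d → ℝ} {N : ℝ} (hf : Measurable f) (hfW : memW Ω s p α β f)
    (hN : ∀ x, |f x| ≤ N) (hu : Measurable u) (hu1 : ∀ x, |u x| ≤ 1)
    (hB : ∀ z : Rd d × Rd d, z.1 ∈ Ω → |incr u z| ≤ cutoffBound Ω z) :
    memW Ω s p α β (fun x => f x * u x) := by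
  rw [memW_iff_memLp hp hf] at hfW
  have hm : Measurable fun x => f x * u x := hf.mul hu
  rw [memW_iff_memLp hp hm]
  refine ⟨hfW.1.mono hm.aestronglyMeasurable (Eventually.of_forall fun x => ?_),
    (hfW.2.abs.add (hM.const_mul N)).mono' (measurable_incr hm).aestronglyMeasurable ?_⟩
  · rw [norm_mul]
    exact mul_le_of_le_one_right (norm_nonneg _) (hu1 x)
  · filter_upwards [ae_gagMeasure_mem hopen] with z hz
    exact abs_incr_mul_le (hN _) (hu1 _) (hB z hz.1)

theorem tendsto_wNorm_mul_cutoff (hp : 0 < p) (hopen : IsOpen Ω) (hfr : (frontier Ω).Nonempty)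
    (hM : MemLp (cutoffBound Ω) (ENNReal.ofReal p) (gagMeasure Ω s p α β))
    {f : Rd d → ℝ} {N : ℝ} (hf : Measurable f) (hfW : memW Ω s p α β f)
    (hN : ∀ x, |f x| ≤ N) :
    Tendsto (fun n => wNorm Ω s p α β (fun x => f x * cutoff Ω n x)) atTop (nhds 0) := by
  rw [memW_iff_memLp hp hf] at hfW
  have hm : ∀ n, Measurable fun x => f x * cutoff Ω n x := fun n => hf.mul (measurable_cutoff n)
  have hc : ∀ n x, |cutoff Ω n x| ≤ 1 := fun n x => by
    rw [abs_of_nonneg (cutoff_nonneg n x)]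
    exact cutoff_le_one n x
  simp only [fun n => wNorm_eq_eLpNorm_add (Ω := Ω) (s := s) (α := α) (β := β) hp (hm n)]
  have hlim : ∀ x ∈ Ω, Tendsto (fun n => f x * cutoff Ω n x) atTop (nhds 0) := fun x hx => by
    simpa using (tendsto_cutoff hopen hfr hx).const_mul (f x)
  rw [← add_zero (0 : ℝ≥0∞)]
  refine Tendsto.add ?_ ?_
  · refine tendsto_eLpNorm_zero_of_dominated hp (fun N => (hm N).aestronglyMeasurable)
      hfW.1.abs (fun n => Eventually.of_forall fun x => ?_) ?_
    · rw [abs_mul]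
      exact mul_le_of_le_one_right (abs_nonneg _) (hc n x)
    · filter_upwards [ae_restrict_mem hopen.measurableSet] with x hx using hlim x hx
  · refine tendsto_eLpNorm_zero_of_dominated hp
      (fun n => (measurable_incr (hm n)).aestronglyMeasurable)
      (hfW.2.abs.add (hM.const_mul N)) (fun n => ?_) ?_
    · filter_upwards [ae_gagMeasure_mem hopen] with z hz
      exact abs_incr_mul_le (hN _) (hc _ _) (abs_incr_cutoff_le hopen hfr n hz.1)
    · filter_upwards [ae_gagMeasure_mem hopen] with z hz
      simpa [incr] using (hlim z.1 hz.1).sub (hlim z.2 hz.2)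

/-- The function on `ℝ^d × ℝ^d` whose `L^p` norm is the unweighted Gagliardo seminorm on `Ω`. -/
noncomputable def gagQuot (Ω : Set (Rd d)) (s p : ℝ) (g : Rd d → ℝ) : Rd d × Rd d → ℝ :=
  (Ω ×ˢ Ω).indicator fun z => incr g z * (dist z.1 z.2 ^ (((d : ℝ) + s * p) / p))⁻¹

theorem enorm_mul_inv_rpow (hp : 0 < p) (a : ℝ) {r : ℝ} (hr : 0 ≤ r) (b : ℝ) :
    ‖a * (r ^ (b / p))⁻¹‖ₑ ^ p = ENNReal.ofReal (r ^ b)⁻¹ * ‖a‖ₑ ^ p := by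
  rw [enorm_mul, ENNReal.mul_rpow_of_nonneg _ _ hp.le, mul_comm]
  congr 1
  rw [Real.enorm_of_nonneg (by positivity), ENNReal.ofReal_rpow_of_nonneg (by positivity) hp.le,
    Real.inv_rpow (by positivity), ← Real.rpow_mul hr, div_mul_cancel₀ _ hp.ne']

theorem memLp_gagQuot (hp : 0 < p) (hopen : IsOpen Ω) (hbdd : Bornology.IsBounded Ω)
    (hfr : (frontier Ω).Nonempty) (hα0 : 0 ≤ α) (hβ0 : 0 ≤ β) {g : Rd d → ℝ} (hg : Measurable g)
    (hgW : memW Ω s p α β g) : MemLp (gagQuot Ω s p g) (ENNReal.ofReal p) volume := by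
  obtain ⟨D, hD0, hD⟩ := exists_distBd_le hbdd
  have hgi := measurable_incr hg
  have hms := hopen.measurableSet.prod hopen.measurableSet
  have hgW2 := ((memW_iff_memLp hp hg).1 hgW).2
  refine (memLp_indicator_iff_restrict hms).2 ⟨by fun_prop, ?_⟩
  have hfin := hgW2.2
  rw [eLpNorm_eq_lintegral_rpow_enorm_toReal (by simpa using hp) ENNReal.ofReal_ne_top,
    ENNReal.toReal_ofReal hp.le, ENNReal.rpow_lt_top_iff_of_pos (by positivity)] at hfin ⊢
  rw [lintegral_gagMeasure (hgi.enorm.pow_const p), Measure.prod_restrict] at hfin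
  refine lt_of_le_of_lt ?_ (ENNReal.mul_lt_top
    (ENNReal.ofReal_lt_top (r := D ^ β * D ^ α)) hfin)
  have hm : Measurable fun z => ENNReal.ofReal (gagKernel Ω s p α β z) * ‖incr g z‖ₑ ^ p :=
    measurable_gagKernel.ennreal_ofReal.mul (hgi.enorm.pow_const p)
  rw [← lintegral_const_mul _ hm, ← Measure.volume_eq_prod]
  refine lintegral_mono_ae ?_
  filter_upwards [ae_restrict_mem hms] with z hz
  have h1 := distBd_pos hopen hfr hz.1
  have h2 := distBd_pos hopen hfr hz.2
  rw [enorm_mul_inv_rpow hp _ dist_nonneg, ← mul_assoc, ← ENNReal.ofReal_mul (by positivity)]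
  gcongr
  have hw : ∀ {t γ : ℝ}, 0 < t → t ≤ D → 0 ≤ γ → 1 ≤ D ^ γ * t ^ (-γ) := by
    intro t γ ht htD hγ
    rw [Real.rpow_neg ht.le, ← div_eq_mul_inv, one_le_div (by positivity)]
    gcongr
  unfold gagKernel
  calc (dist z.1 z.2 ^ ((d : ℝ) + s * p))⁻¹ = (dist z.1 z.2 ^ ((d : ℝ) + s * p))⁻¹ * (1 * 1) := by
        ring
    _ ≤ (dist z.1 z.2 ^ ((d : ℝ) + s * p))⁻¹ *
        ((D ^ β * distBd Ω z.2 ^ (-β)) * (D ^ α * distBd Ω z.1 ^ (-α))) := by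
        gcongr
        · exact hw h2 (hD _ hz.2) hβ0
        · exact hw h1 (hD _ hz.1) hα0
    _ = _ := by ring

/-- The translation difference `g(x) - g(v + x)`. -/
def transDiff (g : Rd d → ℝ) (v x : Rd d) : ℝ := g x - g (v + x)

theorem mem_and_le_distBd_of_shift (hopen : IsOpen Ω) {v x : Rd d} {δ ρ : ℝ} (hv : ‖v‖ ≤ ρ)
    (hρ : ρ < δ) (hx : v + x ∈ Ω ∧ δ ≤ distBd Ω (v + x)) : x ∈ Ω ∧ δ - ρ ≤ distBd Ω x := by
  have hdist : dist (v + x) x = ‖v‖ := by rw [dist_eq_norm, add_sub_cancel_right]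
  refine ⟨mem_of_dist_lt_distBd hopen hx.1 (by linarith [hx.2]), ?_⟩
  have := distBd_le_distBd_add_dist (Ω := Ω) (v + x) x
  linarith [hx.2]

theorem gagKernel_mul_transDiff_le (hp : 0 < p) (hs0 : 0 < s) (hopen : IsOpen Ω)
    (hα0 : 0 ≤ α) (hβ0 : 0 ≤ β) {g : Rd d → ℝ} {η : ℝ} (hη : 0 < η)
    (hsupp : ∀ x, g x ≠ 0 → x ∈ Ω ∧ 3 * η ≤ distBd Ω x) {v : Rd d} (hv : ‖v‖ < η)
    {z : Rd d × Rd d} (hz1 : z.1 ∈ Ω) (hz2 : z.2 ∈ Ω) :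
    ENNReal.ofReal (gagKernel Ω s p α β z) * ‖incr (transDiff g v) z‖ₑ ^ p ≤
      ENNReal.ofReal (η ^ (-β) * η ^ (-α)) *
          ‖gagQuot Ω s p g z - gagQuot Ω s p g ((v, v) + z)‖ₑ ^ p +
        (ENNReal.ofReal ((η ^ ((d : ℝ) + s * p))⁻¹ * η ^ (-α)) *
          (‖transDiff g v z.1‖ₑ ^ p * ENNReal.ofReal (distBd Ω z.2 ^ (-β))) +
        ENNReal.ofReal ((η ^ ((d : ℝ) + s * p))⁻¹ * η ^ (-β)) *
          (ENNReal.ofReal (distBd Ω z.1 ^ (-α)) * ‖transDiff g v z.2‖ₑ ^ p)) := by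
  obtain ⟨x, y⟩ := z
  simp only at hz1 hz2 ⊢
  have hdx := distBd_nonneg (Ω := Ω) x
  have hdy := distBd_nonneg (Ω := Ω) y
  have hsupp' : ∀ x, transDiff g v x ≠ 0 → 2 * η ≤ distBd Ω x := by
    intro x hx
    by_cases h0 : g x = 0
    · have h1 : g (v + x) ≠ 0 := fun h1 => hx (by simp [transDiff, h0, h1])
      have := (mem_and_le_distBd_of_shift hopen hv.le (by linarith) (hsupp _ h1)).2
      linarith
    · linarith [(hsupp x h0).2]
  have hdist := distBd_le_distBd_add_dist (Ω := Ω) x y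
  have hdist' := distBd_le_distBd_add_dist (Ω := Ω) y x
  rw [dist_comm] at hdist'
  have hexp : 0 ≤ (d : ℝ) + s * p := by positivity
  have hw : ∀ {t γ : ℝ}, η ≤ t → 0 ≤ γ → t ^ (-γ) ≤ η ^ (-γ) := fun ht hγ =>
    Real.rpow_le_rpow_of_nonpos hη ht (by linarith)
  have hk : η ≤ dist x y →
      (dist x y ^ ((d : ℝ) + s * p))⁻¹ ≤ (η ^ ((d : ℝ) + s * p))⁻¹ := fun h => by gcongr
  rcases lt_or_ge (distBd Ω y) η with hy | hy
  · have hy0 : transDiff g v y = 0 := by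
      by_contra h
      linarith [hsupp' y h]
    refine le_trans ?_ (le_trans le_self_add le_add_self)
    have hi : incr (transDiff g v) (x, y) = transDiff g v x := by simp [incr, hy0]
    rw [hi]
    by_cases hx0 : transDiff g v x = 0
    · simp [hx0, hp]
    have hx2 := hsupp' x hx0
    rw [mul_comm (‖_‖ₑ ^ p), ← mul_assoc, ← ENNReal.ofReal_mul (by positivity)]
    gcongr
    have hkη := hk (by linarith)
    have hwη := hw (t := distBd Ω x) (by linarith) hα0
    calc (dist x y ^ ((d : ℝ) + s * p))⁻¹ * distBd Ω y ^ (-β) * distBd Ω x ^ (-α)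
        ≤ (η ^ ((d : ℝ) + s * p))⁻¹ * distBd Ω y ^ (-β) * η ^ (-α) := by gcongr ?_ * _ * ?_
      _ = _ := by ring
  rcases lt_or_ge (distBd Ω x) η with hx | hx
  · have hx0 : transDiff g v x = 0 := by
      by_contra h
      linarith [hsupp' x h]
    refine le_trans ?_ (le_trans le_add_self le_add_self)
    have hi : ‖incr (transDiff g v) (x, y)‖ₑ = ‖transDiff g v y‖ₑ := by simp [incr, hx0]
    rw [hi]
    by_cases hy0 : transDiff g v y = 0
    · simp [hy0, hp]
    have hy2 := hsupp' y hy0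
    rw [← mul_assoc, ← ENNReal.ofReal_mul (by positivity)]
    gcongr
    have hkη := hk (by linarith)
    have hwη := hw (t := distBd Ω y) (by linarith) hβ0
    calc (dist x y ^ ((d : ℝ) + s * p))⁻¹ * distBd Ω y ^ (-β) * distBd Ω x ^ (-α)
        ≤ (η ^ ((d : ℝ) + s * p))⁻¹ * η ^ (-β) * distBd Ω x ^ (-α) := by gcongr ?_ * ?_ * _
      _ = _ := by ring
  · refine le_trans ?_ le_self_add
    have hmem : ∀ {x}, x ∈ Ω → η ≤ distBd Ω x → v + x ∈ Ω := by
      intro x hx hηx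
      refine mem_of_dist_lt_distBd hopen hx ?_
      rw [dist_comm, dist_eq_norm, add_sub_cancel_right]
      linarith
    have hq : gagQuot Ω s p g (x, y) - gagQuot Ω s p g ((v, v) + (x, y)) =
        incr (transDiff g v) (x, y) * (dist x y ^ (((d : ℝ) + s * p) / p))⁻¹ := by
      rw [gagQuot, indicator_of_mem (show (x, y) ∈ Ω ×ˢ Ω from ⟨hz1, hz2⟩),
        indicator_of_mem (show (v, v) + (x, y) ∈ Ω ×ˢ Ω from ⟨hmem hz1 hx, hmem hz2 hy⟩)]
      simp only [incr, transDiff, Prod.mk_add_mk, dist_add_left]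
      ring
    rw [hq, enorm_mul_inv_rpow hp _ dist_nonneg, ← mul_assoc,
      ← ENNReal.ofReal_mul (by positivity)]
    gcongr
    have hwy := hw hy hβ0
    have hwx := hw hx hα0
    calc (dist x y ^ ((d : ℝ) + s * p))⁻¹ * distBd Ω y ^ (-β) * distBd Ω x ^ (-α)
        ≤ (dist x y ^ ((d : ℝ) + s * p))⁻¹ * η ^ (-β) * η ^ (-α) := by gcongr _ * ?_ * ?_
      _ = _ := by ring

end Approximation

section Mollification

variable {d : ℕ} {Ω : Set (Rd d)} {s p α β : ℝ}

theorem lintegral_enorm_rpow_eq {X : Type*} [MeasurableSpace X] {μ : Measure X} (hp : 0 < p)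
    (f : X → ℝ) : ∫⁻ x, ‖f x‖ₑ ^ p ∂μ = eLpNorm f (ENNReal.ofReal p) μ ^ p := by
  rw [eLpNorm_eq_lintegral_rpow_enorm_toReal (by simpa using hp) ENNReal.ofReal_ne_top,
    ENNReal.toReal_ofReal hp.le, ← ENNReal.rpow_mul, one_div, inv_mul_cancel₀ hp.ne',
    ENNReal.rpow_one]

theorem measurable_transDiff {g : Rd d → ℝ} (hg : Measurable g) (v : Rd d) :
    Measurable (transDiff g v) :=
  hg.sub (hg.comp (measurable_const_add v))

theorem measurable_gagQuot (hopen : IsOpen Ω) {g : Rd d → ℝ} (hg : Measurable g) :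
    Measurable (gagQuot Ω s p g) := by
  have := measurable_incr hg
  exact Measurable.indicator (by fun_prop) (hopen.measurableSet.prod hopen.measurableSet)

theorem eLpNorm_incr_transDiff_rpow_le (hp : 0 < p) (hs0 : 0 < s) (hopen : IsOpen Ω)
    (hα0 : 0 ≤ α) (hβ0 : 0 ≤ β) {g : Rd d → ℝ} (hg : Measurable g) {η : ℝ} (hη : 0 < η)
    (hsupp : ∀ x, g x ≠ 0 → x ∈ Ω ∧ 3 * η ≤ distBd Ω x) {v : Rd d} (hv : ‖v‖ < η) :
    eLpNorm (incr (transDiff g v)) (ENNReal.ofReal p) (gagMeasure Ω s p α β) ^ p ≤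
      ENNReal.ofReal (η ^ (-β) * η ^ (-α)) *
          eLpNorm (fun z => gagQuot Ω s p g z - gagQuot Ω s p g ((v, v) + z))
            (ENNReal.ofReal p) volume ^ p +
        (ENNReal.ofReal ((η ^ ((d : ℝ) + s * p))⁻¹ * η ^ (-α)) *
          (eLpNorm (transDiff g v) (ENNReal.ofReal p) volume ^ p *
            ∫⁻ x in Ω, ENNReal.ofReal (distBd Ω x ^ (-β))) +
        ENNReal.ofReal ((η ^ ((d : ℝ) + s * p))⁻¹ * η ^ (-β)) *
          ((∫⁻ x in Ω, ENNReal.ofReal (distBd Ω x ^ (-α))) *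
            eLpNorm (transDiff g v) (ENNReal.ofReal p) volume ^ p)) := by
  have ht := measurable_transDiff hg v
  have hq := measurable_gagQuot (s := s) (p := p) hopen hg
  have hdb := measurable_distBd (Ω := Ω)
  have htp : Measurable fun x => ‖transDiff g v x‖ₑ ^ p := ht.enorm.pow_const p
  have hα' : Measurable fun x => ENNReal.ofReal (distBd Ω x ^ (-α)) := by fun_prop
  have hβ' : Measurable fun x => ENNReal.ofReal (distBd Ω x ^ (-β)) := by fun_prop
  have hQ : Measurable fun z => ‖gagQuot Ω s p g z - gagQuot Ω s p g ((v, v) + z)‖ₑ ^ p :=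
    (hq.sub (hq.comp (measurable_const_add _))).enorm.pow_const p
  have hA : Measurable fun z : Rd d × Rd d =>
      ‖transDiff g v z.1‖ₑ ^ p * ENNReal.ofReal (distBd Ω z.2 ^ (-β)) :=
    (htp.comp measurable_fst).mul (hβ'.comp measurable_snd)
  have hB : Measurable fun z : Rd d × Rd d =>
      ENNReal.ofReal (distBd Ω z.1 ^ (-α)) * ‖transDiff g v z.2‖ₑ ^ p :=
    (hα'.comp measurable_fst).mul (htp.comp measurable_snd)
  have hmem : ∀ᵐ z ∂((volume.restrict Ω).prod (volume.restrict Ω)), z.1 ∈ Ω ∧ z.2 ∈ Ω := by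
    rw [Measure.prod_restrict]
    filter_upwards [ae_restrict_mem (hopen.measurableSet.prod hopen.measurableSet)] with z hz
    exact hz
  rw [← lintegral_enorm_rpow_eq hp,
    lintegral_gagMeasure ((measurable_incr ht).enorm.pow_const p)]
  refine (lintegral_mono_ae (hmem.mono fun z hz => gagKernel_mul_transDiff_le hp hs0 hopen hα0 hβ0
    hη hsupp hv hz.1 hz.2)).trans ?_
  rw [lintegral_add_left (hQ.const_mul _), lintegral_add_left (hA.const_mul _),
    lintegral_const_mul _ hQ, lintegral_const_mul _ hA, lintegral_const_mul _ hB,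
    lintegral_prod_mul htp.aemeasurable hβ'.aemeasurable,
    lintegral_prod_mul hα'.aemeasurable htp.aemeasurable, Measure.prod_restrict,
    ← Measure.volume_eq_prod, ← lintegral_enorm_rpow_eq hp, ← lintegral_enorm_rpow_eq hp]
  gcongr <;> exact Measure.restrict_le_self

theorem tendsto_eLpNorm_transDiff (hp : 1 ≤ p) {g : Rd d → ℝ}
    (hgL : MemLp g (ENNReal.ofReal p) volume) :
    Tendsto (fun v => eLpNorm (transDiff g v) (ENNReal.ofReal p) volume) (nhds 0) (nhds 0) :=
  tendsto_eLpNorm_translate_sub hp hgL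

theorem tendsto_eLpNorm_incr_transDiff (hp : 1 ≤ p) (hs0 : 0 < s) (hopen : IsOpen Ω)
    (hbdd : Bornology.IsBounded Ω) (hfr : (frontier Ω).Nonempty) (hα0 : 0 ≤ α) (hβ0 : 0 ≤ β)
    (hα : ∫⁻ x in Ω, ENNReal.ofReal (distBd Ω x ^ (-α)) < ⊤)
    (hβ : ∫⁻ x in Ω, ENNReal.ofReal (distBd Ω x ^ (-β)) < ⊤) {g : Rd d → ℝ} (hg : Measurable g)
    (hgW : memW Ω s p α β g) (hgL : MemLp g (ENNReal.ofReal p) volume) {η : ℝ} (hη : 0 < η)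
    (hsupp : ∀ x, g x ≠ 0 → x ∈ Ω ∧ 3 * η ≤ distBd Ω x) :
    Tendsto (fun v => eLpNorm (incr (transDiff g v)) (ENNReal.ofReal p) (gagMeasure Ω s p α β))
      (nhds 0) (nhds 0) := by
  have hp' : 0 < p := by linarith
  have hpow : ∀ {E : Rd d → ℝ≥0∞}, Tendsto E (nhds 0) (nhds 0) →
      Tendsto (fun v => E v ^ p) (nhds 0) (nhds 0) := fun hE => by
    simpa [hp'] using hE.ennrpow_const p
  have hT := hpow (tendsto_eLpNorm_transDiff hp hgL)
  have hdiag : Tendsto (fun v : Rd d => (v, v)) (nhds 0) (nhds 0) :=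
    (continuous_id.prodMk continuous_id).tendsto' _ _ rfl
  have : (volume : Measure (Rd d × Rd d)).IsAddHaarMeasure := by
    rw [Measure.volume_eq_prod]
    infer_instance
  have hQ := hpow ((tendsto_eLpNorm_translate_sub hp
    (memLp_gagQuot hp' hopen hbdd hfr hα0 hβ0 hg hgW)).comp hdiag)
  have hbound := (ENNReal.Tendsto.const_mul hQ (Or.inr (ENNReal.ofReal_ne_top
    (r := η ^ (-β) * η ^ (-α))))).add
    ((ENNReal.Tendsto.const_mul (ENNReal.Tendsto.mul_const hT (Or.inr hβ.ne))
      (Or.inr (ENNReal.ofReal_ne_top (r := (η ^ ((d : ℝ) + s * p))⁻¹ * η ^ (-α))))).add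
    (ENNReal.Tendsto.const_mul (ENNReal.Tendsto.const_mul hT (Or.inr hα.ne))
      (Or.inr (ENNReal.ofReal_ne_top (r := (η ^ ((d : ℝ) + s * p))⁻¹ * η ^ (-β))))))
  simp only [mul_zero, zero_mul, add_zero] at hbound
  have hlim : Tendsto (fun v => eLpNorm (incr (transDiff g v)) (ENNReal.ofReal p)
      (gagMeasure Ω s p α β) ^ p) (nhds 0) (nhds 0) := by
    refine tendsto_of_tendsto_of_tendsto_of_le_of_le' tendsto_const_nhds hbound
      (Eventually.of_forall fun _ => zero_le) ?_
    filter_upwards [Metric.ball_mem_nhds (0 : Rd d) hη] with v hv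
    exact eLpNorm_incr_transDiff_rpow_le hp' hs0 hopen hα0 hβ0 hg hη hsupp
      (by simpa using hv)
  have := hlim.ennrpow_const p⁻¹
  simpa [← ENNReal.rpow_mul, mul_inv_cancel₀ hp'.ne', hp'] using this

/-- The mollification of `g` by the normalized bump function `ψ`. -/
noncomputable def mollify (ψ : ContDiffBump (0 : Rd d)) (g : Rd d → ℝ) (x : Rd d) : ℝ :=
  ∫ t, ψ.normed volume t * g (x - t)

/-- The probability measure whose density is the normalized bump function `ψ`. -/
noncomputable def bumpMeasure (ψ : ContDiffBump (0 : Rd d)) : Measure (Rd d) :=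
  volume.withDensity fun t => ENNReal.ofReal (ψ.normed volume t)

instance (ψ : ContDiffBump (0 : Rd d)) : IsProbabilityMeasure (bumpMeasure ψ) := by
  refine ⟨?_⟩
  rw [bumpMeasure, withDensity_apply _ MeasurableSet.univ, Measure.restrict_univ,
    ← ofReal_integral_eq_lintegral_ofReal ψ.integrable_normed
      (Eventually.of_forall ψ.nonneg_normed), ψ.integral_normed, ENNReal.ofReal_one]

theorem ae_bumpMeasure_norm_lt (ψ : ContDiffBump (0 : Rd d)) :
    ∀ᵐ t ∂bumpMeasure ψ, ‖t‖ < ψ.rOut := by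
  have hm : Measurable fun t => ENNReal.ofReal (ψ.normed volume t) :=
    ψ.continuous_normed.measurable.ennreal_ofReal
  rw [bumpMeasure, ae_withDensity_iff hm]
  refine Eventually.of_forall fun t ht => ?_
  have : t ∈ Function.support (ψ.normed volume) := fun h => ht (by simp [h])
  rw [ψ.support_normed_eq] at this
  simpa using this

theorem mollify_eq_convolution (ψ : ContDiffBump (0 : Rd d)) (g : Rd d → ℝ) :
    mollify ψ g = convolution (ψ.normed volume) g (ContinuousLinearMap.lsmul ℝ ℝ) volume := rfl

theorem contDiff_mollify (ψ : ContDiffBump (0 : Rd d)) {g : Rd d → ℝ}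
    (hg : LocallyIntegrable g volume) : ContDiff ℝ (⊤ : ℕ∞) (mollify ψ g) := by
  rw [mollify_eq_convolution]
  exact ψ.hasCompactSupport_normed.contDiff_convolution_left _ ψ.contDiff_normed hg

theorem integrable_normed_mul (ψ : ContDiffBump (0 : Rd d)) {g : Rd d → ℝ}
    (hg : LocallyIntegrable g volume) (x : Rd d) :
    Integrable fun t => ψ.normed volume t * g (x - t) :=
  ψ.hasCompactSupport_normed.convolutionExists_left (ContinuousLinearMap.lsmul ℝ ℝ)
    ψ.continuous_normed hg x

theorem integrable_transDiff (ψ : ContDiffBump (0 : Rd d)) {g : Rd d → ℝ}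
    (hg : LocallyIntegrable g volume) (x : Rd d) :
    Integrable (fun t => transDiff g (-t) x) (bumpMeasure ψ) := by
  have hm : Measurable fun t => ENNReal.ofReal (ψ.normed volume t) :=
    ψ.continuous_normed.measurable.ennreal_ofReal
  rw [bumpMeasure, integrable_withDensity_iff_integrable_smul' hm
    (Eventually.of_forall fun _ => ENNReal.ofReal_lt_top)]
  refine ((ψ.integrable_normed.mul_const (g x)).sub (integrable_normed_mul ψ hg x)).congr
    (Eventually.of_forall fun t => ?_)
  simp only [Pi.sub_apply, ENNReal.toReal_ofReal (ψ.nonneg_normed t), smul_eq_mul, transDiff,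
    neg_add_eq_sub]
  ring

theorem sub_mollify_eq (ψ : ContDiffBump (0 : Rd d)) {g : Rd d → ℝ}
    (hg : LocallyIntegrable g volume) (x : Rd d) :
    g x - mollify ψ g x = ∫ t, transDiff g (-t) x ∂bumpMeasure ψ := by
  have hm : Measurable fun t => ENNReal.ofReal (ψ.normed volume t) :=
    ψ.continuous_normed.measurable.ennreal_ofReal
  rw [bumpMeasure, integral_withDensity_eq_integral_toReal_smul hm
    (Eventually.of_forall fun _ => ENNReal.ofReal_lt_top)]
  calc g x - mollify ψ g x
      = ∫ t, (ψ.normed volume t * g x - ψ.normed volume t * g (x - t)) := by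
        rw [integral_sub (ψ.integrable_normed.mul_const (g x)) (integrable_normed_mul ψ hg x),
          integral_mul_const, ψ.integral_normed, one_mul, mollify]
    _ = _ := by
        refine integral_congr_ae (Eventually.of_forall fun t => ?_)
        simp only [ENNReal.toReal_ofReal (ψ.nonneg_normed t), smul_eq_mul, transDiff,
          neg_add_eq_sub]
        ring

theorem mollify_eq_zero (ψ : ContDiffBump (0 : Rd d)) {g : Rd d → ℝ} {x : Rd d}
    (h : ∀ t, ‖t‖ < ψ.rOut → g (x - t) = 0) : mollify ψ g x = 0 := by
  refine integral_eq_zero_of_ae (Eventually.of_forall fun t => ?_)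
  by_cases ht : t ∈ Function.support (ψ.normed volume)
  · rw [ψ.support_normed_eq] at ht
    simp [h t (by simpa using ht)]
  · simp [Function.notMem_support.1 ht]

theorem wNorm_sub_mollify_le (hp : 1 ≤ p) (ψ : ContDiffBump (0 : Rd d)) {g : Rd d → ℝ}
    (hg : Measurable g) (hgi : LocallyIntegrable g volume) {ε₁ ε₂ : ℝ≥0∞}
    (h₁ : ∀ v, ‖v‖ < ψ.rOut → eLpNorm (transDiff g v) (ENNReal.ofReal p) volume ≤ ε₁)
    (h₂ : ∀ v, ‖v‖ < ψ.rOut →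
      eLpNorm (incr (transDiff g v)) (ENNReal.ofReal p) (gagMeasure Ω s p α β) ≤ ε₂) :
    wNorm Ω s p α β (fun x => g x - mollify ψ g x) ≤ ε₁ + ε₂ := by
  have hm : Measurable fun x => g x - mollify ψ g x :=
    hg.sub (contDiff_mollify ψ hgi).continuous.measurable
  have hF : Measurable (Function.uncurry fun t x => transDiff g (-t) x) :=
    (hg.comp measurable_snd).sub
      (hg.comp ((measurable_neg.comp measurable_fst).add measurable_snd))
  rw [wNorm_eq_eLpNorm_add (by linarith) hm]
  refine add_le_add ?_ ?_
  · simp only [sub_mollify_eq ψ hgi]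
    refine eLpNorm_integral_le hp hF ?_
    filter_upwards [ae_bumpMeasure_norm_lt ψ] with t ht
    exact (eLpNorm_mono_measure _ Measure.restrict_le_self).trans (h₁ _ (by simpa using ht))
  · have hincr : incr (fun x => g x - mollify ψ g x) =
        fun z => ∫ t, incr (transDiff g (-t)) z ∂bumpMeasure ψ := by
      ext z
      simp only [incr, sub_mollify_eq ψ hgi]
      exact (integral_sub (integrable_transDiff ψ hgi _) (integrable_transDiff ψ hgi _)).symm
    rw [hincr]
    refine eLpNorm_integral_le hp ?_ ?_
    · exact (hF.comp (measurable_fst.prodMk (measurable_fst.comp measurable_snd))).sub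
        (hF.comp (measurable_fst.prodMk (measurable_snd.comp measurable_snd)))
    filter_upwards [ae_bumpMeasure_norm_lt ψ] with t ht
    exact h₂ _ (by simpa using ht)

theorem exists_contDiff_wNorm_sub_le_of_support (hp : 1 ≤ p) (hs0 : 0 < s) (hopen : IsOpen Ω)
    (hbdd : Bornology.IsBounded Ω) (hfr : (frontier Ω).Nonempty) (hα0 : 0 ≤ α) (hβ0 : 0 ≤ β)
    (hα : ∫⁻ x in Ω, ENNReal.ofReal (distBd Ω x ^ (-α)) < ⊤)
    (hβ : ∫⁻ x in Ω, ENNReal.ofReal (distBd Ω x ^ (-β)) < ⊤) {g : Rd d → ℝ} (hg : Measurable g)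
    (hgW : memW Ω s p α β g) (hgL : MemLp g (ENNReal.ofReal p) volume) {η : ℝ} (hη : 0 < η)
    (hsupp : ∀ x, g x ≠ 0 → x ∈ Ω ∧ 3 * η ≤ distBd Ω x) {ε : ℝ≥0∞} (hε : 0 < ε) :
    ∃ φ : Rd d → ℝ, ContDiff ℝ (⊤ : ℕ∞) φ ∧ HasCompactSupport φ ∧ tsupport φ ⊆ Ω ∧
      wNorm Ω s p α β (fun x => g x - φ x) ≤ ε := by
  have hε2 : 0 < ε / 2 := ENNReal.half_pos hε.ne'
  have hev := ((tendsto_eLpNorm_transDiff hp hgL).eventually_lt_const hε2).and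
    ((tendsto_eLpNorm_incr_transDiff hp hs0 hopen hbdd hfr hα0 hβ0 hα hβ hg hgW hgL hη
      hsupp).eventually_lt_const hε2)
  obtain ⟨ρ, hρ, hball⟩ := Metric.eventually_nhds_iff.1 hev
  have hr : 0 < min ρ η := lt_min hρ hη
  let ψ : ContDiffBump (0 : Rd d) := ⟨min ρ η / 2, min ρ η, by linarith, by linarith⟩
  have hψη : ψ.rOut ≤ η := min_le_right _ _
  have hball' : ∀ v : Rd d, ‖v‖ < ψ.rOut → dist v 0 < ρ := fun v hv => by
    rw [dist_zero_right]
    exact hv.trans_le (min_le_left _ _)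
  have hgi : LocallyIntegrable g volume := hgL.locallyIntegrable (by simpa using hp)
  have hK := isCompact_distBd_ge (δ := 2 * η) hbdd hopen (by positivity)
  have hzero : ∀ x, x ∉ {x | x ∈ Ω ∧ 2 * η ≤ distBd Ω x} → mollify ψ g x = 0 := by
    intro x hx
    refine mollify_eq_zero ψ fun t ht => ?_
    by_contra h
    refine hx ?_
    rw [← neg_add_eq_sub] at h
    have := mem_and_le_distBd_of_shift hopen (v := -t) (ρ := η) (by rw [norm_neg]; linarith)
      (by linarith) (hsupp _ h)
    exact ⟨this.1, by linarith [this.2]⟩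
  refine ⟨mollify ψ g, contDiff_mollify ψ hgi, HasCompactSupport.intro hK hzero, ?_, ?_⟩
  · refine (closure_minimal ?_ hK.isClosed).trans fun x hx => hx.1
    intro x hx
    by_contra h
    exact hx (hzero x h)
  · rw [← ENNReal.add_halves ε]
    exact wNorm_sub_mollify_le hp ψ hg hgi (fun v hv => (hball (hball' v hv)).1.le)
      (fun v hv => (hball (hball' v hv)).2.le)

end Mollification

section Density

variable {d : ℕ} {Ω : Set (Rd d)} {s p α β : ℝ}

theorem memW_of_wNorm_sub_lt_top (hp : 1 ≤ p) {f φ : Rd d → ℝ} (hf : Measurable f)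
    (hφ : Measurable φ) (hfW : memW Ω s p α β f)
    (h : wNorm Ω s p α β (fun x => f x - φ x) < ⊤) : memW Ω s p α β φ := by
  have hp' : 0 < p := by linarith
  have hm : Measurable fun x => f x - φ x := hf.sub hφ
  rw [wNorm_eq_eLpNorm_add hp' hm, ENNReal.add_lt_top] at h
  rw [memW_iff_memLp hp' hf] at hfW
  rw [memW_iff_memLp hp' hφ]
  have h1 : φ = f - fun x => f x - φ x := by
    ext x
    simp
  have h2 : incr φ = incr f - incr fun x => f x - φ x := by
    ext z
    simp only [incr, Pi.sub_apply]
    ring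
  refine ⟨?_, ?_⟩
  · rw [h1]
    exact hfW.1.sub ⟨hm.aestronglyMeasurable, h.1⟩
  · rw [h2]
    exact hfW.2.sub ⟨(measurable_incr hm).aestronglyMeasurable, h.2⟩

theorem exists_contDiff_wNorm_sub_le (hd : 0 < d) (hopen : IsOpen Ω)
    (hbdd : Bornology.IsBounded Ω) (hfr : (frontier Ω).Nonempty) (hs0 : 0 < s) (hs1 : s < 1)
    (hp : 1 ≤ p) (hα0 : 0 ≤ α) (hβ0 : 0 ≤ β)
    (h : s * p + α + β < (d : ℝ) - upperMinkDim (frontier Ω)) {f : Rd d → ℝ} (hf : Measurable f)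
    (hfW : memW Ω s p α β f) {ε : ℝ≥0∞} (hε : 0 < ε) :
    ∃ φ : Rd d → ℝ, ContDiff ℝ (⊤ : ℕ∞) φ ∧ HasCompactSupport φ ∧ tsupport φ ⊆ Ω ∧
      wNorm Ω s p α β (fun x => f x - φ x) ≤ ε := by
  have hp' : 0 < p := by linarith
  have hsp : 0 < s * p := by positivity
  have hint : ∀ {q : ℝ}, 0 ≤ q → q ≤ s * p + α + β →
      ∫⁻ x in Ω, ENNReal.ofReal (distBd Ω x ^ (-q)) < ⊤ := fun h0 hq =>
    lintegral_distBd_rpow_lt_top hbdd hfr h0 (hq.trans_lt h)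
  have hM := memLp_cutoffBound hd hopen hfr hs0 hs1 hp hα0 hβ0 (hint (by positivity) le_rfl)
  have hε3 : 0 < ε / 3 := ENNReal.div_pos hε.ne' (by simp)
  obtain ⟨N, hN⟩ := ((tendsto_wNorm_sub_trunc hp' hf hfW).eventually_lt_const hε3).exists
  have hfN : Measurable fun x => trunc N (f x) := (measurable_trunc N).comp hf
  have hfNW := memW_trunc hp' hf hfW N
  obtain ⟨n, hn, hn1⟩ := (((tendsto_wNorm_mul_cutoff hp' hopen hfr hM hfN hfNW
    (fun x => abs_trunc_le N (f x))).eventually_lt_const hε3).and (eventually_ge_atTop 1)).exists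
  have hn0 : (0 : ℝ) < n := by exact_mod_cast hn1
  have hu : Measurable fun x => 1 - cutoff Ω n x := measurable_const.sub (measurable_cutoff n)
  have hu1 : ∀ x, |1 - cutoff Ω n x| ≤ 1 := fun x => by
    have := cutoff_nonneg (Ω := Ω) n x
    have := cutoff_le_one (Ω := Ω) n x
    rw [abs_le]
    constructor <;> linarith
  have hgW' := memW_mul hp' hopen hM hfN hfNW (fun x => abs_trunc_le N (f x)) hu hu1
    fun z hz => by
      have : incr (fun x => 1 - cutoff Ω n x) z = -incr (cutoff Ω n) z := by
        simp only [incr]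
        ring
      rw [this, abs_neg]
      exact abs_incr_cutoff_le hopen hfr n hz
  let g : Rd d → ℝ := Ω.indicator fun x => trunc N (f x) * (1 - cutoff Ω n x)
  have hg : Measurable g := (hfN.mul hu).indicator hopen.measurableSet
  have hgW : memW Ω s p α β g := (memW_congr (indicator_ae_eq_restrict hopen.measurableSet)).2 hgW'
  have hgL : MemLp g (ENNReal.ofReal p) volume :=
    (memLp_indicator_iff_restrict hopen.measurableSet).2 hgW'.1
  have hsupp : ∀ x, g x ≠ 0 → x ∈ Ω ∧ 3 * ((n : ℝ)⁻¹ / 3) ≤ distBd Ω x := by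
    intro x hx
    refine ⟨mem_of_indicator_ne_zero hx, ?_⟩
    by_contra! hlt
    refine hx (indicator_apply_eq_zero.2 fun _ => ?_)
    rw [cutoff_eq_one, sub_self, mul_zero]
    calc n * distBd Ω x ≤ n * (n : ℝ)⁻¹ := by gcongr; linarith
      _ = 1 := mul_inv_cancel₀ hn0.ne'
  obtain ⟨φ, hφ, hφc, hφΩ, hφε⟩ := exists_contDiff_wNorm_sub_le_of_support hp hs0 hopen hbdd hfr hα0 hβ0
    (hint hα0 (by linarith)) (hint hβ0 (by linarith)) hg hgW hgL (by positivity) hsupp hε3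
  refine ⟨φ, hφ, hφc, hφΩ, ?_⟩
  have hφm : Measurable φ := hφ.continuous.measurable
  have hm₁ : Measurable fun x => f x - trunc N (f x) := hf.sub hfN
  have hm₂ : Measurable fun x => trunc N (f x) * cutoff Ω n x := hfN.mul (measurable_cutoff n)
  have hm₃ : Measurable fun x => g x - φ x := hg.sub hφm
  have hm₂₃ : Measurable fun x => trunc N (f x) * cutoff Ω n x + (g x - φ x) := hm₂.add hm₃
  calc wNorm Ω s p α β (fun x => f x - φ x)
      = wNorm Ω s p α β (fun x => (f x - trunc N (f x)) +
          (trunc N (f x) * cutoff Ω n x + (g x - φ x))) := by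
        refine wNorm_congr ?_
        filter_upwards [ae_restrict_mem hopen.measurableSet] with x hx
        simp only [g, indicator_of_mem hx]
        ring
    _ ≤ ε / 3 + (ε / 3 + ε / 3) :=
        (wNorm_add_le hp hm₁ hm₂₃).trans
          (add_le_add hN.le ((wNorm_add_le hp hm₂ hm₃).trans (add_le_add hn.le hφε)))
    _ = ε := by rw [← add_assoc, ENNReal.add_thirds]

end Density

/-- if `sp + α + β < d - dim_M(∂Ω)` then `W_0^{s,p;α,β}(Ω) = W^{s,p;α,β}(Ω)`. -/
theorem stmt3 {d : ℕ} (Ω : Set (Rd d)) (hne : Ω.Nonempty)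
    (hopen : IsOpen Ω) (hbdd : Bornology.IsBounded Ω) (s p α β : ℝ)
    (hs0 : 0 < s) (hs1 : s < 1) (hp : 1 ≤ p) (hα0 : 0 ≤ α) (hβ0 : 0 ≤ β)
    (h : s * p + α + β < (d : ℝ) - upperMinkDim (frontier Ω)) :
    ∀ f : Rd d → ℝ, memW Ω s p α β f ↔ memW0 Ω s p α β f := by
  refine fun f => ⟨fun hfW => ⟨hfW, fun ε hε => ?_⟩, fun hfW => hfW.1⟩
  have hd : 0 < d := by
    have h0 := upperMinkDim_nonneg (frontier Ω)
    have hsp : 0 < s * p := by positivity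
    have : (0 : ℝ) < d := by linarith
    exact_mod_cast this
  have hfr := frontier_nonempty_of_bounded hd hne hbdd
  have hm : Measurable (hfW.1.1.mk f) := hfW.1.1.stronglyMeasurable_mk.measurable
  have hae := hfW.1.1.ae_eq_mk
  have hmW := (memW_congr hae).1 hfW
  obtain ⟨φ, hφ, hφc, hφΩ, hle⟩ := exists_contDiff_wNorm_sub_le hd hopen hbdd hfr hs0 hs1 hp hα0
    hβ0 h hm hmW (ENNReal.half_pos (ENNReal.ofReal_pos.2 hε).ne')
  have hlt := hle.trans_lt (ENNReal.half_lt_self (ENNReal.ofReal_pos.2 hε).ne'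
    ENNReal.ofReal_ne_top)
  refine ⟨φ, hφ, hφc, hφΩ, memW_of_wNorm_sub_lt_top hp hm hφ.continuous.measurable hmW
    (hlt.trans ENNReal.ofReal_lt_top), ?_⟩
  rwa [wNorm_congr (hae.mono fun x hx => by rw [hx])]
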